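/- arXiv:0903.1496 — 8 statements merged into one kernel-verified Lean document; each statement's English description precedes it below -/
import Mathlib

section
/- lim_{n→∞} (1/n^d) · (1/2)·log det( I + σ^{−2} Σ_{X,n} ) = (1/(2π)^d) ∫_{[−π,π)^d} (1/2)·log( (σ² + (2π)^d f(ω))/σ² ) dω. (The left-hand side is the per-sample mutual information between the stationary Gaussian signal X on 𝒟ₙ and its observation in i.i.d. N(0,σ²) noise; this establishes the d-dimensional spectral-domain mutual information rate.) -/
open MeasureTheory Filter Matrix Real

namespace MIR

def J {d n : ℕ} (i : Fin d → Fin n) : Fin d → ℤ := fun k => (i k : ℤ)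

lemma J_inj {d n : ℕ} : Function.Injective (J : (Fin d → Fin n) → (Fin d → ℤ)) := by
  intro i j h
  funext k
  have := congrFun h k
  simp only [J] at this
  exact Fin.ext (by exact_mod_cast this)

open Classical in
/-- indicator that `J i - h` leaves the box -/
noncomputable def bad {d n : ℕ} (i : Fin d → Fin n) (h : Fin d → ℤ) : ℝ :=
  if ∃ l : Fin d → Fin n, J l = J i - h then 0 else 1

lemma bad_nonneg {d n : ℕ} (i : Fin d → Fin n) (h : Fin d → ℤ) : 0 ≤ bad i h := by
  unfold bad; split_ifs <;> norm_num

lemma bad_le {d n : ℕ} (i : Fin d → Fin n) (h : Fin d → ℤ) : bad i h ≤ 1 := by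
  unfold bad; split_ifs <;> norm_num

lemma good_card {d n : ℕ} (h : Fin d → ℤ) :
    ∑ i : Fin d → Fin n, (1 - bad i h) =
      ∏ k : Fin d, ((Finset.univ.filter fun x : Fin n => 0 ≤ (x : ℤ) - h k ∧ (x : ℤ) - h k < n).card : ℝ) := by
  classical
  have h1 : ∀ i : Fin d → Fin n, 1 - bad i h =
      if i ∈ Fintype.piFinset (fun k => Finset.univ.filter
        fun x : Fin n => 0 ≤ (x : ℤ) - h k ∧ (x : ℤ) - h k < n) then 1 else 0 := by
    intro i
    have : (∃ l : Fin d → Fin n, J l = J i - h) ↔ i ∈ Fintype.piFinset (fun k => Finset.univ.filter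
        fun x : Fin n => 0 ≤ (x : ℤ) - h k ∧ (x : ℤ) - h k < n) := by
      simp only [Fintype.mem_piFinset, Finset.mem_filter, Finset.mem_univ, true_and]
      constructor
      · rintro ⟨l, hl⟩ k
        have := congrFun hl k
        simp only [J, Pi.sub_apply] at this
        have h2 := (l k).2
        omega
      · intro H
        refine ⟨fun k => ⟨((i k : ℤ) - h k).toNat, ?_⟩, ?_⟩
        · have := H k; omega
        · funext k
          have := H k
          simp only [J, Pi.sub_apply]
          omega
    unfold bad
    simp only [this]
    split_ifs <;> norm_num
  simp_rw [h1]
  rw [Finset.sum_boole, Finset.filter_mem_eq_inter, Finset.univ_inter, Fintype.card_piFinset]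
  push_cast
  rfl

lemma card1 (n : ℕ) (m : ℤ) :
    (n : ℝ) - |(m : ℝ)| ≤ ((Finset.univ.filter fun x : Fin n => 0 ≤ (x : ℤ) - m ∧ (x : ℤ) - m < n).card : ℝ) := by
  classical
  have h1 : (Finset.univ.filter fun x : Fin n => ¬ (0 ≤ (x : ℤ) - m ∧ (x : ℤ) - m < n)).card ≤ m.natAbs := by
    rw [← Finset.card_range m.natAbs]
    apply Finset.card_le_card_of_injOn (fun x : Fin n => if 0 ≤ m then (x : ℕ) else n - 1 - x)
    · intro x hx
      simp only [Finset.coe_filter, Finset.mem_univ, true_and, Set.mem_ofPred_eq] at hx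
      have := x.2
      simp only [Finset.coe_range, Set.mem_Iio]
      split_ifs <;> omega
    · intro x hx y hy hxy
      have := x.2
      have := y.2
      ext
      simp only at hxy
      split_ifs at hxy <;> omega
  have h2 := Finset.card_filter_add_card_filter_not (s := (Finset.univ : Finset (Fin n)))
    (fun x : Fin n => 0 ≤ (x : ℤ) - m ∧ (x : ℤ) - m < n)
  rw [Finset.card_univ, Fintype.card_fin] at h2
  have h3 : |(m : ℝ)| = (m.natAbs : ℝ) := by
    rw [Nat.cast_natAbs]; simp
  rw [h3]
  have : (n : ℝ) ≤ ((Finset.univ.filter fun x : Fin n => 0 ≤ (x : ℤ) - m ∧ (x : ℤ) - m < n).card : ℝ) + m.natAbs := by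
    exact_mod_cast (by omega)
  linarith

lemma bad_tendsto {d : ℕ} (h : Fin d → ℤ) :
    Tendsto (fun n : ℕ => (1 / (n : ℝ) ^ d) * ∑ i : Fin d → Fin n, bad i h) atTop (nhds 0) := by
  have key : ∀ m : ℤ, Tendsto (fun n : ℕ =>
      ((Finset.univ.filter fun x : Fin n => 0 ≤ (x : ℤ) - m ∧ (x : ℤ) - m < n).card : ℝ) / n)
      atTop (nhds 1) := by
    intro m
    have l1 : Tendsto (fun n : ℕ => 1 - |(m : ℝ)| / n) atTop (nhds 1) := by
      have := (tendsto_const_nhds (x := (1 : ℝ)) (f := atTop)).sub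
        (tendsto_const_div_atTop_nhds_zero_nat |(m : ℝ)|)
      simpa using this
    refine tendsto_of_tendsto_of_tendsto_of_le_of_le' l1 tendsto_const_nhds ?_ ?_
    · filter_upwards [eventually_gt_atTop 0] with n hn
      have hn' : (0 : ℝ) < n := by exact_mod_cast hn
      rw [le_div_iff₀ hn', sub_mul, div_mul_cancel₀ _ hn'.ne', one_mul]
      exact card1 n m
    · filter_upwards with n
      apply div_le_one_of_le₀ _ (Nat.cast_nonneg _)
      have := Finset.card_filter_le (Finset.univ : Finset (Fin n)) (fun x : Fin n => 0 ≤ (x : ℤ) - m ∧ (x : ℤ) - m < n)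
      rw [Finset.card_univ, Fintype.card_fin] at this
      exact_mod_cast this
  have h2 := tendsto_finsetProd (Finset.univ : Finset (Fin d)) (fun k _ => key (h k))
  have h3 := (tendsto_const_nhds (x := (1 : ℝ)) (f := atTop)).sub h2
  simp only [Finset.prod_const_one, sub_self] at h3
  refine h3.congr' ?_
  filter_upwards [eventually_gt_atTop 0] with n hn
  have hn' : (0 : ℝ) < n := by exact_mod_cast hn
  rw [Finset.prod_div_distrib, ← good_card]
  simp only [Finset.sum_sub_distrib, Finset.sum_const, Finset.card_univ, Fintype.card_pi, Fintype.card_fin,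
    Finset.prod_const, nsmul_eq_mul, mul_one]
  push_cast
  field_simp
  ring

lemma tail_tendsto {d : ℕ} (b : (Fin d → ℤ) → ℝ) (hb : Summable fun h => |b h|) :
    Tendsto (fun n : ℕ => (1 / (n : ℝ) ^ d) * ∑ i : Fin d → Fin n, ∑' h, |b h| * bad i h)
      atTop (nhds 0) := by
  have hs : ∀ (n : ℕ) (i : Fin d → Fin n), Summable fun h => |b h| * bad i h := fun n i =>
    Summable.of_nonneg_of_le (fun h => mul_nonneg (abs_nonneg _) (bad_nonneg i h))
      (fun h => mul_le_of_le_one_right (abs_nonneg _) (bad_le i h)) hb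
  have e : ∀ n : ℕ, (1 / (n : ℝ) ^ d) * ∑ i : Fin d → Fin n, ∑' h, |b h| * bad i h =
      ∑' h, |b h| * ((1 / (n : ℝ) ^ d) * ∑ i : Fin d → Fin n, bad i h) := by
    intro n
    rw [← Summable.tsum_finsetSum (fun i _ => hs n i), ← tsum_mul_left]
    congr 1; funext h
    rw [← Finset.mul_sum]; ring
  simp_rw [e]
  have := tendsto_tsum_of_dominated_convergence (𝓕 := atTop) (f := fun (n : ℕ) h => |b h| * ((1 / (n : ℝ) ^ d) * ∑ i : Fin d → Fin n, bad i h)) (g := fun _ => 0) (bound := fun h => |b h|) hb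
    (fun h => by simpa using (bad_tendsto h).const_mul |b h|) ?_
  · simpa using this
  · filter_upwards [eventually_gt_atTop 0] with n hn h
    have hn' : (0 : ℝ) < n := by exact_mod_cast hn
    have h0 : 0 ≤ ∑ i : Fin d → Fin n, bad i h := Finset.sum_nonneg fun i _ => bad_nonneg i h
    rw [Real.norm_of_nonneg (by positivity)]
    apply mul_le_of_le_one_right (abs_nonneg _)
    rw [one_div, inv_mul_le_iff₀ (by positivity), mul_one]
    refine (Finset.sum_le_sum fun i _ => bad_le i h).trans ?_
    simp

/-- convolution -/
noncomputable def conv {d : ℕ} (b a : (Fin d → ℤ) → ℝ) (m : Fin d → ℤ) : ℝ := ∑' h, b h * a (m - h)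

lemma summable_shift {d : ℕ} (a : (Fin d → ℤ) → ℝ) (ha : Summable fun h => |a h|) (m : Fin d → ℤ) :
    Summable fun h => |a (m - h)| :=
  (Equiv.subLeft m).summable_iff (f := fun h => |a h|) |>.2 ha

lemma abs_le_tsum {d : ℕ} (a : (Fin d → ℤ) → ℝ) (ha : Summable fun h => |a h|) (m : Fin d → ℤ) :
    |a m| ≤ ∑' h, |a h| := ha.le_tsum m (fun _ _ => abs_nonneg _)

lemma summable_conv {d : ℕ} (b a : (Fin d → ℤ) → ℝ) (hb : Summable fun h => |b h|)
    (ha : Summable fun h => |a h|) (m : Fin d → ℤ) : Summable fun h => |b h * a (m - h)| := by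
  refine Summable.of_nonneg_of_le (fun _ => abs_nonneg _) (fun h => ?_) (hb.mul_right (∑' h, |a h|))
  rw [abs_mul]
  exact mul_le_mul_of_nonneg_left (abs_le_tsum a ha _) (abs_nonneg _)

lemma row_sum_le {d n : ℕ} (a : (Fin d → ℤ) → ℝ) (ha : Summable fun h => |a h|) (m : Fin d → ℤ) :
    ∑ j : Fin d → Fin n, |a (m - J j)| ≤ ∑' h, |a h| := by
  have hinj : Function.Injective (fun j : Fin d → Fin n => m - J j) := by
    intro x y h
    exact J_inj (by simpa using h)
  rw [← tsum_fintype (L := .unconditional _)]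
  exact Summable.tsum_le_tsum_of_inj _ hinj (fun _ _ => abs_nonneg _) (fun _ => le_rfl) (Summable.of_finite) ha

lemma step_entry {d n : ℕ} (a b : (Fin d → ℤ) → ℝ) (ha : Summable fun h => |a h|)
    (hb : Summable fun h => |b h|) (A : Matrix (Fin d → Fin n) (Fin d → Fin n) ℝ)
    (i j : Fin d → Fin n) :
    |∑ l, A i l * a (J l - J j) - conv b a (J i - J j)| ≤
      ∑ l, |A i l - b (J i - J l)| * |a (J l - J j)| + ∑' h, |b h| * bad i h * |a (J i - h - J j)| := by
  have hc : conv b a (J i - J j) = ∑ l : Fin d → Fin n, b (J i - J l) * a (J l - J j) +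
      ∑' h, b h * bad i h * a (J i - h - J j) := by
    have hS := summable_conv b a hb ha (J i - J j)
    have hg : Summable fun h => b h * (1 - bad i h) * a (J i - h - J j) := by
      refine Summable.of_norm_bounded hS (fun h => ?_)
      rw [Real.norm_eq_abs, abs_mul, abs_mul, abs_mul, sub_right_comm]
      have h1 : |1 - bad i h| ≤ 1 := abs_le.2 ⟨by linarith [bad_le i h], by linarith [bad_nonneg i h]⟩
      exact mul_le_mul_of_nonneg_right (mul_le_of_le_one_right (abs_nonneg _) h1) (abs_nonneg _)
    have hbd : Summable fun h => b h * bad i h * a (J i - h - J j) := by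
      refine Summable.of_norm_bounded hS (fun h => ?_)
      rw [Real.norm_eq_abs, abs_mul, abs_mul, abs_mul, sub_right_comm]
      have h1 : |bad i h| ≤ 1 := abs_le.2 ⟨by linarith [bad_nonneg i h], by linarith [bad_le i h]⟩
      exact mul_le_mul_of_nonneg_right (mul_le_of_le_one_right (abs_nonneg _) h1) (abs_nonneg _)
    have hinj : Function.Injective (fun l : Fin d → Fin n => J i - J l) := by
      intro x y h
      exact J_inj (by simpa using h)
    have e : ∑ l : Fin d → Fin n, b (J i - J l) * a (J l - J j) = ∑' h, b h * (1 - bad i h) * a (J i - h - J j) := by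
      rw [← hinj.tsum_eq (f := fun h => b h * (1 - bad i h) * a (J i - h - J j)), tsum_fintype]
      · refine Finset.sum_congr rfl fun l _ => ?_
        have : bad i (J i - J l) = 0 := by
          unfold bad; rw [if_pos ⟨l, by simp⟩]
        simp [this]
      · intro h hh
        by_contra hne
        apply hh
        have : bad i h = 1 := by
          unfold bad; rw [if_neg]
          rintro ⟨l, hl⟩
          exact hne ⟨l, by simp [hl]⟩
        simp [this]
    rw [e, ← hg.tsum_add hbd]
    unfold conv
    refine tsum_congr fun h => ?_
    rw [sub_right_comm]; ring
  rw [hc]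
  have e2 : ∑ l, A i l * a (J l - J j) - (∑ l : Fin d → Fin n, b (J i - J l) * a (J l - J j) +
      ∑' h, b h * bad i h * a (J i - h - J j)) = ∑ l, (A i l - b (J i - J l)) * a (J l - J j)
      - ∑' h, b h * bad i h * a (J i - h - J j) := by
    simp only [sub_mul, Finset.sum_sub_distrib]; ring
  rw [e2]
  refine (abs_sub _ _).trans (add_le_add ?_ ?_)
  · refine (Finset.abs_sum_le_sum_abs _ _).trans (le_of_eq ?_)
    simp only [abs_mul]
  · have hs : Summable fun h => |b h| * bad i h * |a (J i - h - J j)| := by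
      refine Summable.of_nonneg_of_le (fun h => ?_) (fun h => ?_) (summable_conv b a hb ha (J i - J j))
      · have := bad_nonneg i h; positivity
      · rw [abs_mul, sub_right_comm]
        exact mul_le_mul_of_nonneg_right (mul_le_of_le_one_right (abs_nonneg _) (bad_le i h)) (abs_nonneg _)
    have := norm_tsum_le_tsum_norm (f := fun h => b h * bad i h * a (J i - h - J j)) ?_
    · simpa [abs_mul, abs_of_nonneg (bad_nonneg i _)] using this
    · simpa [abs_mul, abs_of_nonneg (bad_nonneg i _)] using hs

lemma step_sum {d n : ℕ} (a b : (Fin d → ℤ) → ℝ) (ha : Summable fun h => |a h|)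
    (hb : Summable fun h => |b h|) (A : Matrix (Fin d → Fin n) (Fin d → Fin n) ℝ) :
    ∑ i, ∑ j : Fin d → Fin n, |∑ l, A i l * a (J l - J j) - conv b a (J i - J j)| ≤
      (∑' h, |a h|) * (∑ i, ∑ j, |A i j - b (J i - J j)| + ∑ i : Fin d → Fin n, ∑' h, |b h| * bad i h) := by
  rw [← Finset.sum_add_distrib, Finset.mul_sum]
  refine Finset.sum_le_sum fun i _ => ?_
  refine (Finset.sum_le_sum fun j _ => step_entry a b ha hb A i j).trans ?_
  rw [Finset.sum_add_distrib, mul_add]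
  refine add_le_add ?_ ?_
  · rw [Finset.sum_comm, Finset.mul_sum]
    refine Finset.sum_le_sum fun l _ => ?_
    rw [← Finset.mul_sum, mul_comm]
    exact mul_le_mul_of_nonneg_right (row_sum_le a ha _) (abs_nonneg _)
  · have hs : ∀ j : Fin d → Fin n, Summable fun h => |b h| * bad i h * |a (J i - h - J j)| := by
      intro j
      refine Summable.of_nonneg_of_le (fun h => ?_) (fun h => ?_) (summable_conv b a hb ha (J i - J j))
      · have := bad_nonneg i h; positivity
      · rw [abs_mul, sub_right_comm]
        exact mul_le_mul_of_nonneg_right (mul_le_of_le_one_right (abs_nonneg _) (bad_le i h)) (abs_nonneg _)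
    have hs2 : Summable fun h => |b h| * bad i h :=
      Summable.of_nonneg_of_le (fun h => mul_nonneg (abs_nonneg _) (bad_nonneg i h))
      (fun h => mul_le_of_le_one_right (abs_nonneg _) (bad_le i h)) hb
    rw [← Summable.tsum_finsetSum (fun j _ => hs j), ← tsum_mul_left]
    refine Summable.tsum_le_tsum (fun h => ?_) (summable_sum fun j _ => hs j) (hs2.mul_left _)
    rw [← Finset.mul_sum, mul_comm]
    exact mul_le_mul_of_nonneg_right (row_sum_le a ha _) (mul_nonneg (abs_nonneg _) (bad_nonneg i h))


noncomputable def ee {d : ℕ} (h : Fin d → ℤ) (w : Fin d → ℝ) : ℂ :=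
  Complex.exp (((∑ k, (h k : ℝ) * w k : ℝ) : ℂ) * Complex.I)

lemma ee_norm {d : ℕ} (h : Fin d → ℤ) (w : Fin d → ℝ) : ‖ee h w‖ = 1 :=
  Complex.norm_exp_ofReal_mul_I _

lemma ee_add {d : ℕ} (h l : Fin d → ℤ) (w : Fin d → ℝ) : ee (h + l) w = ee h w * ee l w := by
  unfold ee
  rw [← Complex.exp_add, ← add_mul, ← Complex.ofReal_add, ← Finset.sum_add_distrib]
  congr 3
  refine Finset.sum_congr rfl fun k _ => ?_
  simp; ring

lemma ee_zero {d : ℕ} (w : Fin d → ℝ) : ee 0 w = 1 := by simp [ee]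

def shear (d : ℕ) : ((Fin d → ℤ) × (Fin d → ℤ)) ≃ ((Fin d → ℤ) × (Fin d → ℤ)) where
  toFun p := (p.2, p.1 - p.2)
  invFun p := (p.1 + p.2, p.1)
  left_inv p := by simp
  right_inv p := by simp

lemma conv_summable {d : ℕ} (b a : (Fin d → ℤ) → ℝ) (hb : Summable fun h => |b h|)
    (ha : Summable fun h => |a h|) : Summable fun m => |conv b a m| := by
  have h1 : Summable fun p : (Fin d → ℤ) × (Fin d → ℤ) => |b p.1| * |a p.2| :=
    hb.mul_of_nonneg ha (fun _ => abs_nonneg _) (fun _ => abs_nonneg _)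
  have h2 := ((shear d).summable_iff.2 h1)
  have h3 := h2.prod
  refine Summable.of_nonneg_of_le (fun _ => abs_nonneg _) (fun m => ?_) h3
  have := norm_tsum_le_tsum_norm (f := fun h => b h * a (m - h)) (summable_conv b a hb ha m)
  simpa [abs_mul, shear, conv] using this

lemma pair_hasSum {ι : Type*} (u v : ι → ℂ) (hu : Summable fun h => ‖u h‖)
    (hv : Summable fun h => ‖v h‖) (S1 S2 : ℂ) (h1 : HasSum u S1) (h2 : HasSum v S2) :
    HasSum (fun p : ι × ι => u p.1 * v p.2) (S1 * S2) := by
  have n3 : Summable fun p : ι × ι => ‖u p.1‖ * ‖v p.2‖ :=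
    hu.mul_of_nonneg hv (fun _ => norm_nonneg _) (fun _ => norm_nonneg _)
  have n4 : Summable fun p : ι × ι => u p.1 * v p.2 := by
    refine Summable.of_norm_bounded n3 fun p => ?_
    rw [norm_mul]
  exact HasSum.mul h1 h2 n4

lemma conv_hasSum {d : ℕ} (b a : (Fin d → ℤ) → ℝ) (hb : Summable fun h => |b h|)
    (ha : Summable fun h => |a h|) (w : Fin d → ℝ) (S1 S2 : ℂ)
    (h1 : HasSum (fun h => (b h : ℂ) * ee h w) S1) (h2 : HasSum (fun h => (a h : ℂ) * ee h w) S2) :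
    HasSum (fun m => (conv b a m : ℂ) * ee m w) (S1 * S2) := by
  have n1 : Summable fun h => ‖(b h : ℂ) * ee h w‖ := by simpa [ee_norm] using hb
  have n2 : Summable fun h => ‖(a h : ℂ) * ee h w‖ := by simpa [ee_norm] using ha
  have h3 := pair_hasSum _ _ n1 n2 S1 S2 h1 h2
  have h4 : HasSum (fun p : (Fin d → ℤ) × (Fin d → ℤ) =>
      ((b p.2 : ℂ) * ee p.2 w) * ((a (p.1 - p.2) : ℂ) * ee (p.1 - p.2) w)) (S1 * S2) :=
    (shear d).hasSum_iff.2 h3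
  refine HasSum.prod_fiberwise h4 fun m => ?_
  have h5 : HasSum (fun h => ((b h * a (m - h) : ℝ) : ℂ)) (conv b a m : ℂ) :=
    Complex.hasSum_ofReal.2 ((summable_conv b a hb ha m).of_abs.hasSum)
  have h6 := h5.mul_right (ee m w)
  have e : (fun h => ((b h : ℂ) * ee h w) * ((a (m - h) : ℂ) * ee (m - h) w)) =
      fun h => ((b h * a (m - h) : ℝ) : ℂ) * ee m w := by
    funext h
    have : ee m w = ee h w * ee (m - h) w := by rw [← ee_add]; simp
    rw [this]
    push_cast; ring
  show HasSum (fun h => ((b h : ℂ) * ee h w) * ((a (m - h) : ℂ) * ee (m - h) w)) _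
  rw [e]
  exact h6

/-- Toeplitz matrix -/
def T {d : ℕ} (a : (Fin d → ℤ) → ℝ) (n : ℕ) : Matrix (Fin d → Fin n) (Fin d → Fin n) ℝ :=
  Matrix.of fun i j => a (J i - J j)

lemma moments {d : ℕ} (a : (Fin d → ℤ) → ℝ) (ha : Summable fun h => |a h|) (G : (Fin d → ℝ) → ℂ)
    (hG : ∀ w, HasSum (fun h => (a h : ℂ) * ee h w) (G w)) (k : ℕ) :
    ∃ b : (Fin d → ℤ) → ℝ, (Summable fun h => |b h|) ∧
      Tendsto (fun n : ℕ => (1 / (n : ℝ) ^ d) * ∑ i, ∑ j, |(T a n ^ k) i j - b (J i - J j)|) atTop (nhds 0) ∧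
      ∀ w, HasSum (fun h => (b h : ℂ) * ee h w) (G w ^ k) := by
  induction k with
  | zero =>
    refine ⟨Pi.single 0 1, ?_, ?_, ?_⟩
    · apply summable_of_ne_finset_zero (s := {0})
      intro h hh
      simp at hh
      simp [hh]
    · refine tendsto_const_nhds.congr fun n => ?_
      symm
      refine mul_eq_zero_of_right _ (Finset.sum_eq_zero fun i _ => Finset.sum_eq_zero fun j _ => ?_)
      rw [pow_zero, Matrix.one_apply, Pi.single_apply]
      by_cases h : i = j
      · simp [h]
      · have : J i - J j ≠ 0 := fun h' => h (J_inj (sub_eq_zero.1 h'))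
        simp [h, this]
    · intro w
      have := hasSum_single (f := fun h => (((Pi.single 0 1 : (Fin d → ℤ) → ℝ) h : ℝ) : ℂ) * ee h w) 0
        (fun h hh => by simp [hh])
      simpa [ee_zero] using this
  | succ k ih =>
    obtain ⟨b, hb, ht, hS⟩ := ih
    refine ⟨conv b a, conv_summable b a hb ha, ?_, fun w => ?_⟩
    · have h1 := (ht.add (tail_tendsto b hb)).const_mul (∑' h, |a h|)
      simp only [add_zero, mul_zero] at h1
      refine squeeze_zero (fun n => ?_) (fun n => ?_) h1
      · positivity
      · rw [← mul_add, mul_left_comm]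
        refine mul_le_mul_of_nonneg_left ?_ (by positivity)
        refine le_trans (le_of_eq ?_) (step_sum a b ha hb (T a n ^ k))
        refine Finset.sum_congr rfl fun i _ => Finset.sum_congr rfl fun j _ => ?_
        rw [pow_succ, Matrix.mul_apply]
        rfl
    · rw [pow_succ]
      exact conv_hasSum b a hb ha w _ _ (hS w) (hG w)

lemma int1 (m : ℤ) : ∫ x in Set.Ico (-π) π, Complex.exp (((m : ℝ) * x : ℝ) * Complex.I) =
    if m = 0 then (2 * π : ℂ) else 0 := by
  rw [integral_Ico_eq_integral_Ioc, ← intervalIntegral.integral_of_le (by linarith [pi_pos])]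
  split_ifs with h
  · subst h
    simp
    ring
  · have hc : ((m : ℂ) * Complex.I) ≠ 0 := by simp [h]
    have := integral_exp_mul_complex (a := -π) (b := π) hc
    have e : ∀ x : ℝ, Complex.exp ((((m : ℝ) * x : ℝ) : ℂ) * Complex.I) = Complex.exp ((m : ℂ) * Complex.I * x) := by
      intro x; congr 1; push_cast; ring
    simp_rw [e]
    rw [this, div_eq_zero_iff]
    left
    rw [sub_eq_zero, Complex.exp_eq_exp_iff_exists_int]
    exact ⟨m, by push_cast; ring⟩

lemma int_ee {d : ℕ} (h : Fin d → ℤ) :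
    ∫ w in Set.univ.pi fun _ : Fin d => Set.Ico (-π) π, ee h w = if h = 0 then ((2 * π) ^ d : ℂ) else 0 := by
  have e : ∀ w, ee h w = ∏ k, Complex.exp ((((h k : ℝ) * w k : ℝ) : ℂ) * Complex.I) := by
    intro w
    rw [← Complex.exp_sum, ← Finset.sum_mul, ← Complex.ofReal_sum]
    rfl
  simp_rw [e]
  rw [volume_pi, Measure.restrict_pi_pi,
    integral_fintype_prod_eq_prod (fun k (x : ℝ) => Complex.exp ((((h k : ℝ) * x : ℝ) : ℂ) * Complex.I))]
  simp_rw [int1]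
  split_ifs with hh
  · subst hh; simp
  · obtain ⟨k, hk⟩ := Function.ne_iff.1 hh
    exact Finset.prod_eq_zero (Finset.mem_univ k) (if_neg hk)

instance finBox (d : ℕ) : IsFiniteMeasure ((volume : Measure (Fin d → ℝ)).restrict
    (Set.univ.pi fun _ : Fin d => Set.Ico (-π) π)) := by
  rw [volume_pi, Measure.restrict_pi_pi]
  infer_instance

lemma ee_cont {d : ℕ} (h : Fin d → ℤ) : Continuous (ee h) := by
  unfold ee; fun_prop

lemma coef {d : ℕ} (b : (Fin d → ℤ) → ℝ) (hb : Summable fun h => |b h|) (F : (Fin d → ℝ) → ℂ)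
    (hF : ∀ w, HasSum (fun h => (b h : ℂ) * ee h w) (F w)) :
    ∫ w in Set.univ.pi fun _ : Fin d => Set.Ico (-π) π, F w = (2 * π) ^ d * b 0 := by
  have hi : ∀ h, Integrable (fun w => (b h : ℂ) * ee h w) ((volume : Measure (Fin d → ℝ)).restrict
    (Set.univ.pi fun _ : Fin d => Set.Ico (-π) π)) := by
    intro h
    refine Integrable.of_bound (C := |b h|) (by
      apply Continuous.aestronglyMeasurable
      exact continuous_const.mul (ee_cont h)) (Eventually.of_forall fun w => ?_)
    simp [ee_norm]
  have := hasSum_integral_of_summable_integral_norm hi ?_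
  · have e : (∫ w in Set.univ.pi fun _ : Fin d => Set.Ico (-π) π, F w) = ∫ w in Set.univ.pi fun _ : Fin d => Set.Ico (-π) π, ∑' h, (b h : ℂ) * ee h w := by
      congr 1; funext w; exact (hF w).tsum_eq.symm
    rw [e]
    have t2 : (fun h : Fin d → ℤ => ∫ w in Set.univ.pi fun _ : Fin d => Set.Ico (-π) π, (b h : ℂ) * ee h w)
        = fun h : Fin d → ℤ => (b h : ℂ) * if h = 0 then ((2 * π) ^ d : ℂ) else 0 := by
      funext h
      rw [integral_const_mul, int_ee]
    rw [t2] at this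
    refine this.unique ?_
    have t3 := hasSum_single (f := fun h : Fin d → ℤ => (b h : ℂ) * if h = 0 then ((2 * π) ^ d : ℂ) else 0) 0 (fun h hh => by simp [hh])
    rw [if_pos rfl, mul_comm (b 0 : ℂ)] at t3
    exact t3
  · simp only [norm_mul, ee_norm, mul_one, Complex.norm_real, integral_const, smul_eq_mul, Real.norm_eq_abs]
    exact hb.mul_left _

lemma trace_tendsto {d : ℕ} (a : (Fin d → ℤ) → ℝ) (ha : Summable fun h => |a h|) (g : (Fin d → ℝ) → ℝ)
    (hG : ∀ w, HasSum (fun h => (a h : ℂ) * ee h w) (g w : ℂ)) (k : ℕ) :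
    Tendsto (fun n : ℕ => (1 / (n : ℝ) ^ d) * (T a n ^ k).trace) atTop
      (nhds ((1 / (2 * π) ^ d) * ∫ w in Set.univ.pi fun _ : Fin d => Set.Ico (-π) π, g w ^ k)) := by
  obtain ⟨b, hb, ht, hS⟩ := moments a ha (fun w => (g w : ℂ)) hG k
  have hc := coef b hb _ hS
  have hc' : ∫ w in Set.univ.pi fun _ : Fin d => Set.Ico (-π) π, g w ^ k = (2 * π) ^ d * b 0 := by
    have : ((∫ w in Set.univ.pi fun _ : Fin d => Set.Ico (-π) π, g w ^ k : ℝ) : ℂ) = (((2 * π) ^ d * b 0 : ℝ) : ℂ) := by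
      rw [← integral_complex_ofReal]
      push_cast
      exact hc
    exact_mod_cast this
  have hpi := pi_pos
  rw [hc', ← mul_assoc, one_div, inv_mul_cancel₀ (by positivity), one_mul]
  rw [tendsto_iff_norm_sub_tendsto_zero]
  refine squeeze_zero' (Eventually.of_forall fun n => norm_nonneg _) ?_ ht
  filter_upwards [eventually_gt_atTop 0] with n hn
  have hn' : (0 : ℝ) < n := by exact_mod_cast hn
  have e : (1 / (n : ℝ) ^ d) * (T a n ^ k).trace - b 0 =
      (1 / (n : ℝ) ^ d) * ∑ i : Fin d → Fin n, ((T a n ^ k) i i - b 0) := by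
    rw [Finset.sum_sub_distrib]
    simp only [Matrix.trace, Matrix.diag, Finset.sum_const, Finset.card_univ, Fintype.card_pi, Fintype.card_fin,
      Finset.prod_const, nsmul_eq_mul]
    push_cast
    field_simp
  rw [e, norm_mul, Real.norm_of_nonneg (by positivity), Real.norm_eq_abs]
  refine mul_le_mul_of_nonneg_left ?_ (by positivity)
  refine (Finset.abs_sum_le_sum_abs _ _).trans (Finset.sum_le_sum fun i _ => ?_)
  have := Finset.single_le_sum (f := fun j => |(T a n ^ k) i j - b (J i - J j)|) (fun j _ => abs_nonneg _) (Finset.mem_univ i)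
  simpa using this

lemma trace_pow_eig {m : Type*} [Fintype m] [DecidableEq m] (A : Matrix m m ℝ) (hA : A.IsHermitian) (k : ℕ) :
    (A ^ k).trace = ∑ i, hA.eigenvalues i ^ k := by
  conv_lhs => rw [hA.spectral_theorem, ← map_pow, Unitary.conjStarAlgAut_apply, Matrix.trace_mul_cycle]
  simp [Matrix.diagonal_pow, Matrix.trace_diagonal]

lemma det_eig {m : Type*} [Fintype m] [DecidableEq m] (A : Matrix m m ℝ) (hA : A.IsHermitian) :
    (1 + A).det = ∏ i, (1 + hA.eigenvalues i) := by
  conv_lhs => rw [hA.spectral_theorem, ← map_one (Unitary.conjStarAlgAut ℝ _ hA.eigenvectorUnitary), ← map_add, Unitary.conjStarAlgAut_apply,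
    Matrix.det_mul_right_comm]
  rw [← Matrix.diagonal_one, Matrix.diagonal_add]
  simp [Matrix.det_diagonal]

lemma eig_le {d n : ℕ} (a : (Fin d → ℤ) → ℝ) (ha : Summable fun h => |a h|)
    (hA : (T a n).IsHermitian) (i : Fin d → Fin n) : hA.eigenvalues i ≤ ∑' h, |a h| := by
  have h1 : Module.End.HasEigenvalue (Matrix.toLin' (T a n)) (hA.eigenvalues i) := by
    rw [Module.End.hasEigenvalue_iff_mem_spectrum, Matrix.spectrum_toLin']
    exact hA.eigenvalues_mem_spectrum_real i
  obtain ⟨k, hk⟩ := eigenvalue_mem_ball h1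
  rw [Metric.mem_closedBall, Real.dist_eq] at hk
  have h2 := row_sum_le (n := n) a ha (J k)
  rw [← Finset.add_sum_erase _ _ (Finset.mem_univ k)] at h2
  have h3 : (T a n) k k ≤ |a (J k - J k)| := le_abs_self _
  have h4 : ∑ j ∈ Finset.univ.erase k, ‖T a n k j‖ = ∑ j ∈ Finset.univ.erase k, |a (J k - J j)| := rfl
  have h5 := le_abs_self (hA.eigenvalues i - T a n k k)
  linarith

lemma poly_tendsto {d : ℕ} (a : (Fin d → ℤ) → ℝ) (ha : Summable fun h => |a h|) (g : (Fin d → ℝ) → ℝ)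
    (hG : ∀ w, HasSum (fun h => (a h : ℂ) * ee h w) (g w : ℂ))
    (hgi : ∀ k : ℕ, Integrable (fun w => g w ^ k) ((volume : Measure (Fin d → ℝ)).restrict
    (Set.univ.pi fun _ : Fin d => Set.Ico (-π) π)))
    (hA : ∀ n, (T a n).IsHermitian) (p : Polynomial ℝ) :
    Tendsto (fun n : ℕ => (1 / (n : ℝ) ^ d) * ∑ i, p.eval ((hA n).eigenvalues i)) atTop
      (nhds ((1 / (2 * π) ^ d) * ∫ w in Set.univ.pi fun _ : Fin d => Set.Ico (-π) π, p.eval (g w))) := by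
  simp_rw [Polynomial.eval_eq_sum_range]
  rw [integral_finsetSum _ (fun k _ => (hgi k).const_mul _), Finset.mul_sum]
  have := tendsto_finsetSum (Finset.range (p.natDegree + 1)) (fun k _ => (trace_tendsto a ha g hG k).const_mul (p.coeff k))
  convert this using 2 with n k
  · rw [Finset.sum_comm, Finset.mul_sum]
    refine Finset.sum_congr rfl fun k _ => ?_
    rw [trace_pow_eig _ (hA n), ← Finset.mul_sum]; ring
  · refine Finset.sum_congr rfl fun k _ => ?_
    rw [integral_const_mul]; ring

lemma box_vol (d : ℕ) : ((volume : Measure (Fin d → ℝ)).restrict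
    (Set.univ.pi fun _ : Fin d => Set.Ico (-π) π)).real Set.univ = (2 * π) ^ d := by
  rw [measureReal_restrict_apply_univ, measureReal_def, volume_pi_pi]
  simp only [Real.volume_Ico, Finset.prod_const, Finset.card_univ, Fintype.card_fin, ENNReal.toReal_pow]
  rw [ENNReal.toReal_ofReal (by linarith [pi_pos])]
  ring

lemma cont_tendsto {d : ℕ} (a : (Fin d → ℤ) → ℝ) (ha : Summable fun h => |a h|) (g : (Fin d → ℝ) → ℝ)
    (hG : ∀ w, HasSum (fun h => (a h : ℂ) * ee h w) (g w : ℂ)) (hgc : Continuous g)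
    (hg0 : ∀ w, 0 ≤ g w) (hA : ∀ n, (T a n).PosSemidef) (φ : ℝ → ℝ) (hφ : ContinuousOn φ (Set.Ici 0)) :
    Tendsto (fun n : ℕ => (1 / (n : ℝ) ^ d) * ∑ i, φ ((hA n).isHermitian.eigenvalues i)) atTop
      (nhds ((1 / (2 * π) ^ d) * ∫ w in Set.univ.pi fun _ : Fin d => Set.Ico (-π) π, φ (g w))) := by
  set M := ∑' h, |a h| with hM
  have hpi := pi_pos
  have hgM : ∀ w, g w ≤ M := by
    intro w
    have h1 := norm_tsum_le_tsum_norm (f := fun h => (a h : ℂ) * ee h w) (by simpa [ee_norm] using ha)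
    rw [(hG w).tsum_eq] at h1
    simp only [norm_mul, ee_norm, mul_one, Complex.norm_real, Real.norm_eq_abs] at h1
    exact (le_abs_self _).trans h1
  have hint : ∀ ψ : ℝ → ℝ, ContinuousOn ψ (Set.Ici 0) → Integrable (fun w => ψ (g w)) ((volume : Measure (Fin d → ℝ)).restrict
    (Set.univ.pi fun _ : Fin d => Set.Ico (-π) π)) := by
    intro ψ hψ
    obtain ⟨C, hC⟩ := isCompact_Icc.exists_bound_of_continuousOn (hψ.mono (fun x (hx : x ∈ Set.Icc 0 M) => hx.1))
    refine Integrable.of_bound (C := C) ?_ (Eventually.of_forall fun w => hC _ ⟨hg0 w, hgM w⟩)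
    exact (hψ.comp_continuous hgc hg0).aestronglyMeasurable
  rw [Metric.tendsto_atTop']
  intro ε hε
  obtain ⟨p, hp⟩ := exists_polynomial_near_of_continuousOn 0 M φ (hφ.mono Set.Icc_subset_Ici_self) (ε / 4) (by positivity)
  have ht := poly_tendsto a ha g hG (fun k => hint (fun x => x ^ k) (by fun_prop)) (fun n => (hA n).isHermitian) p
  rw [Metric.tendsto_atTop'] at ht
  obtain ⟨N, hN⟩ := ht (ε / 4) (by positivity)
  refine ⟨N, fun n hn => ?_⟩
  have h1 := hN n hn
  have hn0 : 0 < n := by omega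
  have hn' : (0 : ℝ) < n := by exact_mod_cast hn0
  rw [Real.dist_eq] at h1 ⊢
  have h2 : |(1 / (n : ℝ) ^ d) * ∑ i, φ ((hA n).isHermitian.eigenvalues i) -
      (1 / (n : ℝ) ^ d) * ∑ i, p.eval ((hA n).isHermitian.eigenvalues i)| ≤ ε / 4 := by
    rw [← mul_sub, ← Finset.sum_sub_distrib, abs_mul, abs_of_nonneg (by positivity), one_div,
      inv_mul_le_iff₀ (by positivity)]
    refine (Finset.abs_sum_le_sum_abs _ _).trans ?_
    refine (Finset.sum_le_sum (g := fun _ => ε / 4) fun i _ => ?_).trans (le_of_eq ?_)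
    · rw [abs_sub_comm]
      exact (hp _ ⟨(hA n).eigenvalues_nonneg i, eig_le a ha _ i⟩).le
    · simp
  have h3 : |(1 / (2 * π) ^ d) * (∫ w in Set.univ.pi fun _ : Fin d => Set.Ico (-π) π, p.eval (g w)) -
      (1 / (2 * π) ^ d) * ∫ w in Set.univ.pi fun _ : Fin d => Set.Ico (-π) π, φ (g w)| ≤ ε / 4 := by
    rw [← mul_sub, ← integral_sub (hint _ p.continuous.continuousOn) (hint φ hφ), abs_mul, abs_of_nonneg (by positivity), one_div,
      inv_mul_le_iff₀ (by positivity), mul_comm, ← box_vol d, ← Real.norm_eq_abs]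
    exact norm_integral_le_of_norm_le_const (Eventually.of_forall fun w => (hp _ ⟨hg0 w, hgM w⟩).le)
  rw [abs_lt] at h1 ⊢
  rw [abs_le] at h2 h3
  constructor <;> linarith [h1.1, h1.2, h2.1, h2.2, h3.1, h3.2]

lemma real_hasSum {d : ℕ} (a : (Fin d → ℤ) → ℝ) (ha : Summable fun h => |a h|) (hs : ∀ h, a h = a (-h))
    (w : Fin d → ℝ) :
    HasSum (fun h => (a h : ℂ) * ee h w) ((∑' h, a h * Real.cos (∑ k, (h k : ℝ) * w k) : ℝ) : ℂ) := by
  have hS : Summable fun h => (a h : ℂ) * ee h w := by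
    apply Summable.of_norm
    simpa [ee_norm] using ha
  have h1 := hS.hasSum
  have hre : ∀ h, ((a h : ℂ) * ee h w).re = a h * Real.cos (∑ k, (h k : ℝ) * w k) := by
    intro h
    rw [Complex.re_ofReal_mul, ee, Complex.exp_ofReal_mul_I_re]
  have him : ∀ h, ((a h : ℂ) * ee h w).im = a h * Real.sin (∑ k, (h k : ℝ) * w k) := by
    intro h
    rw [Complex.im_ofReal_mul, ee, Complex.exp_ofReal_mul_I_im]
  have key : ∑' h, (a h : ℂ) * ee h w = ((∑' h, a h * Real.cos (∑ k, (h k : ℝ) * w k) : ℝ) : ℂ) := by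
    apply Complex.ext
    · rw [Complex.re_tsum hS, Complex.ofReal_re]
      simp_rw [hre]
    · rw [Complex.im_tsum hS, Complex.ofReal_im]
      simp_rw [him]
      have e := (Equiv.neg (Fin d → ℤ)).tsum_eq (fun h => a h * Real.sin (∑ k, (h k : ℝ) * w k))
      have e2 : ∀ h : Fin d → ℤ, a ((Equiv.neg _) h) * Real.sin (∑ k, (((Equiv.neg (Fin d → ℤ)) h k : ℤ) : ℝ) * w k)
          = - (a h * Real.sin (∑ k, (h k : ℝ) * w k)) := by
        intro h
        simp only [Equiv.neg_apply, ← hs h, Pi.neg_apply, Int.cast_neg, neg_mul, Finset.sum_neg_distrib, Real.sin_neg]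
        ring
      simp_rw [e2] at e
      rw [tsum_neg] at e
      linarith
  rw [← key]
  exact h1

end MIR

open MeasureTheory Filter Matrix Real

/-- **Spectral-domain mutual information rate in `d` dimensions**: the per-sample
mutual information `(1/(2 n^d)) log det(I + σ⁻² Σ_{X,n})` between the stationary
Gaussian signal on `𝒟ₙ` and its observation in i.i.d. `N(0,σ²)` noise converges
to the spectral integral `(2π)^{-d} ∫ (1/2) log((σ² + (2π)^d f(ω))/σ²) dω`. -/
theorem mutual_information_rate_dD
    (d : ℕ) (hd : 1 ≤ d) (σ2 : ℝ) (hσ2 : 0 < σ2)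
    (c : (Fin d → ℤ) → ℝ) (hsym : ∀ h, c h = c (-h))
    (hA2 : ∀ k : Fin d, Summable fun h : Fin d → ℤ => (1 + |(h k : ℝ)|) * |c h|)
    (f : (Fin d → ℝ) → ℝ)
    (hf : ∀ w : Fin d → ℝ,
      f w = (2 * π) ^ (-(d : ℤ)) * ∑' h : Fin d → ℤ, c h * Real.cos (∑ k, (h k : ℝ) * w k))
    (hfnn : ∀ w : Fin d → ℝ, 0 ≤ f w)
    (SigX : (n : ℕ) → Matrix (Fin d → Fin n) (Fin d → Fin n) ℝ)
    (hSigX : ∀ n (i j : Fin d → Fin n), SigX n i j = c fun k => (i k : ℤ) - (j k : ℤ))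
    (hpsd : ∀ n, (SigX n).PosSemidef) :
    Tendsto
      (fun n : ℕ =>
        (1 / (n : ℝ) ^ d) * ((1 / 2) * Real.log ((1 + σ2⁻¹ • SigX n).det)))
      atTop
      (nhds ((1 / (2 * π) ^ d) *
        ∫ w in Set.univ.pi fun _ : Fin d => Set.Ico (-π) π,
          (1 / 2) * Real.log ((σ2 + (2 * π) ^ d * f w) / σ2))) := by
  have hk0 := hA2 ⟨0, hd⟩
  have hcs : Summable fun h => |c h| := by
    refine Summable.of_nonneg_of_le (fun _ => abs_nonneg _) (fun h => ?_) hk0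
    have := abs_nonneg ((h ⟨0, hd⟩ : ℤ) : ℝ)
    have := abs_nonneg (c h)
    nlinarith
  set a : (Fin d → ℤ) → ℝ := fun h => σ2⁻¹ * c h with ha_def
  have ha : Summable fun h => |a h| := by
    simp only [ha_def, abs_mul]
    exact hcs.mul_left _
  set g : (Fin d → ℝ) → ℝ := fun w => ∑' h, a h * Real.cos (∑ k, (h k : ℝ) * w k) with hg_def
  have hG : ∀ w, HasSum (fun h => (a h : ℂ) * MIR.ee h w) (g w : ℂ) := fun w =>
    MIR.real_hasSum a ha (fun h => by simp only [ha_def]; rw [hsym h]) w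
  have hgc : Continuous g := by
    refine continuous_tsum (fun h => by fun_prop) ha (fun h w => ?_)
    rw [Real.norm_eq_abs, abs_mul]
    exact mul_le_of_le_one_right (abs_nonneg _) (Real.abs_cos_le_one _)
  have hpi := pi_pos
  have hfg : ∀ w, (2 * π) ^ d * f w = σ2 * g w := by
    intro w
    have : g w = σ2⁻¹ * ∑' h : Fin d → ℤ, c h * Real.cos (∑ k, (h k : ℝ) * w k) := by
      rw [← tsum_mul_left]
      refine tsum_congr fun h => ?_
      simp only [ha_def]; ring
    rw [this, hf w, _root_.zpow_neg, zpow_natCast]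
    field_simp
  have hg0 : ∀ w, 0 ≤ g w := by
    intro w
    have h1 : 0 ≤ σ2 * g w := by
      rw [← hfg w]
      exact mul_nonneg (by positivity) (hfnn w)
    exact nonneg_of_mul_nonneg_right h1 hσ2
  have hT : ∀ n, σ2⁻¹ • SigX n = MIR.T a n := by
    intro n
    ext i j
    simp only [Matrix.smul_apply, smul_eq_mul, hSigX, MIR.T, Matrix.of_apply, ha_def]
    rfl
  have hA : ∀ n, (MIR.T a n).PosSemidef := by
    intro n
    rw [← hT n]
    exact (hpsd n).smul (by positivity)
  have main := MIR.cont_tendsto a ha g hG hgc hg0 hA (fun x => (1 / 2) * Real.log (1 + x)) (by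
    refine continuousOn_const.mul (ContinuousOn.log (by fun_prop) ?_)
    intro x hx
    have : (0 : ℝ) ≤ x := hx
    positivity)
  have e1 : ∀ w, (σ2 + (2 * π) ^ d * f w) / σ2 = 1 + g w := by
    intro w
    rw [hfg w]
    field_simp
  simp_rw [e1]
  refine main.congr fun n => ?_
  rw [hT n, MIR.det_eig _ (hA n).isHermitian, Real.log_prod, ← Finset.mul_sum]
  intro i _
  have := (hA n).eigenvalues_nonneg i
  positivity
end

section
/- For every SNR > 0 and every ζ ∈ [0, 1/4), the asymptotic per-node Kullback–Leibler information is strictly smaller than the asymptotic per-node mutual information: 𝒦ₛ(SNR, ζ) < ℐₛ(SNR, ζ). Moreover, for each fixed ζ ∈ [0, 1/4), the difference converges to 1/2 at high SNR: lim_{SNR→∞} ( ℐₛ(SNR, ζ) − 𝒦ₛ(SNR, ζ) ) = 1/2. -/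
open Real MeasureTheory Filter

/-- The complete elliptic integral of the first kind,
`K(k) = ∫₀^{π/2} (1 - k² sin²θ)^{-1/2} dθ`. -/
noncomputable def ellipticK (k : ℝ) : ℝ :=
  ∫ t in (0 : ℝ)..(π / 2), (1 - k ^ 2 * Real.sin t ^ 2) ^ (-(1 / 2) : ℝ)

/-- `D_ζ(ω₁,ω₂) = 1 − 2ζ cos ω₁ − 2ζ cos ω₂`. -/
noncomputable def Dz (ζ ω₁ ω₂ : ℝ) : ℝ :=
  1 - 2 * ζ * Real.cos ω₁ - 2 * ζ * Real.cos ω₂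

/-- `G_ζ(ω₁,ω₂) = 1/((2/π) K(4ζ) D_ζ(ω₁,ω₂))`. -/
noncomputable def Gz (ζ ω₁ ω₂ : ℝ) : ℝ :=
  1 / ((2 / π) * ellipticK (4 * ζ) * Dz ζ ω₁ ω₂)

/-- Asymptotic per-node Kullback–Leibler information `𝒦ₛ(SNR, ζ)` of the hidden
SFCAR model. -/
noncomputable def Ks (snr ζ : ℝ) : ℝ :=
  (1 / (4 * π ^ 2)) * ∫ ω₁ in (-π)..π, ∫ ω₂ in (-π)..π,
    ((1 / 2) * Real.log (1 + snr * Gz ζ ω₁ ω₂) -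
      (1 / 2) * (1 - 1 / (1 + snr * Gz ζ ω₁ ω₂)))

/-- Asymptotic per-node mutual information `ℐₛ(SNR, ζ)` of the hidden SFCAR
model. -/
noncomputable def Is (snr ζ : ℝ) : ℝ :=
  (1 / (4 * π ^ 2)) * ∫ ω₁ in (-π)..π, ∫ ω₂ in (-π)..π,
    (1 / 2) * Real.log (1 + snr * Gz ζ ω₁ ω₂)

lemma aux_K_pos (ζ : ℝ) (h : ζ ∈ Set.Ico (0 : ℝ) (1 / 4)) : 0 < ellipticK (4 * ζ) := by
  obtain ⟨h0, h1⟩ := h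
  have hp : ∀ t : ℝ, 0 < 1 - (4 * ζ) ^ 2 * Real.sin t ^ 2 := by
    intro t
    have a : Real.sin t ^ 2 ≤ 1 := Real.sin_sq_le_one t
    have b : (4 * ζ) ^ 2 < 1 := by nlinarith
    nlinarith [sq_nonneg (Real.sin t), sq_nonneg (4 * ζ)]
  unfold ellipticK
  apply intervalIntegral.intervalIntegral_pos_of_pos
  · apply Continuous.intervalIntegrable
    apply Continuous.rpow_const
    · fun_prop
    · intro t; exact Or.inl (hp t).ne'
  · intro t; exact Real.rpow_pos_of_pos (hp t) _
  · positivity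

lemma aux_D_bd (ζ : ℝ) (h : ζ ∈ Set.Ico (0 : ℝ) (1 / 4)) (x y : ℝ) :
    0 < Dz ζ x y ∧ Dz ζ x y ≤ 2 := by
  obtain ⟨h0, h1⟩ := h
  unfold Dz
  constructor <;> nlinarith [Real.cos_le_one x, Real.cos_le_one y, Real.neg_one_le_cos x,
    Real.neg_one_le_cos y]

lemma aux_int_mono (f g : ℝ → ℝ → ℝ) (hf : Continuous (Function.uncurry f))
    (hg : Continuous (Function.uncurry g)) (hfg : ∀ x y, f x y ≤ g x y) :
    ∫ x in (-π)..π, ∫ y in (-π)..π, f x y ≤ ∫ x in (-π)..π, ∫ y in (-π)..π, g x y := by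
  have hpi : -π ≤ π := by linarith [Real.pi_pos]
  apply intervalIntegral.integral_mono hpi
  · exact (intervalIntegral.continuous_parametric_intervalIntegral_of_continuous'
      hf _ _).intervalIntegrable _ _
  · exact (intervalIntegral.continuous_parametric_intervalIntegral_of_continuous'
      hg _ _).intervalIntegrable _ _
  · intro x
    apply intervalIntegral.integral_mono hpi
    · exact (hf.comp (Continuous.prodMk_right x)).intervalIntegrable _ _
    · exact (hg.comp (Continuous.prodMk_right x)).intervalIntegrable _ _
    · exact hfg x

lemma aux_int_sub (f g : ℝ → ℝ → ℝ) (hf : Continuous (Function.uncurry f))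
    (hg : Continuous (Function.uncurry g)) :
    ∫ x in (-π)..π, ∫ y in (-π)..π, (f x y - g x y) =
      (∫ x in (-π)..π, ∫ y in (-π)..π, f x y) - ∫ x in (-π)..π, ∫ y in (-π)..π, g x y := by
  rw [← intervalIntegral.integral_sub]
  · congr 1
    ext x
    rw [intervalIntegral.integral_sub]
    · exact (hf.comp (Continuous.prodMk_right x)).intervalIntegrable _ _
    · exact (hg.comp (Continuous.prodMk_right x)).intervalIntegrable _ _
  · exact (intervalIntegral.continuous_parametric_intervalIntegral_of_continuous'
      hf _ _).intervalIntegrable _ _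
  · exact (intervalIntegral.continuous_parametric_intervalIntegral_of_continuous'
      hg _ _).intervalIntegrable _ _

lemma aux_const (c : ℝ) :
    (1 / (4 * π ^ 2)) * ∫ _x in (-π)..π, ∫ _y in (-π)..π, c = c := by
  have := Real.pi_pos
  simp only [intervalIntegral.integral_const, smul_eq_mul]
  field_simp
  ring

lemma aux_gap (ζ : ℝ) (h : ζ ∈ Set.Ico (0 : ℝ) (1 / 4)) :
    ∃ m : ℝ, 0 < m ∧ ∀ s : ℝ, 0 < s →
      (1 / 2) * (1 - 1 / (1 + s * m)) ≤ Is s ζ - Ks s ζ ∧ Is s ζ - Ks s ζ ≤ 1 / 2 := by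
  have hK := aux_K_pos ζ h
  have hc : 0 < (2 / π) * ellipticK (4 * ζ) := by have := Real.pi_pos; positivity
  have hD := aux_D_bd ζ h
  have hDc : Continuous (fun p : ℝ × ℝ => Dz ζ p.1 p.2) := by unfold Dz; fun_prop
  have hGc : Continuous (fun p : ℝ × ℝ => Gz ζ p.1 p.2) := by
    unfold Gz
    exact continuous_const.div (continuous_const.mul hDc)
      (fun p => (mul_pos hc (hD p.1 p.2).1).ne')
  refine ⟨1 / ((2 / π) * ellipticK (4 * ζ) * 2), by positivity, ?_⟩
  set m := 1 / ((2 / π) * ellipticK (4 * ζ) * 2) with hm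
  have hm0 : 0 < m := by positivity
  have hG : ∀ x y, m ≤ Gz ζ x y := by
    intro x y
    unfold Gz
    exact one_div_le_one_div_of_le (mul_pos hc (hD x y).1)
      (mul_le_mul_of_nonneg_left (hD x y).2 hc.le)
  intro s hs
  have hpos : ∀ x y, 0 < 1 + s * Gz ζ x y := fun x y => by
    have := mul_pos hs (hm0.trans_le (hG x y)); linarith
  have hpc : Continuous (fun p : ℝ × ℝ => 1 + s * Gz ζ p.1 p.2) := by fun_prop
  have c1 : Continuous (Function.uncurry fun x y => (1 / 2) * Real.log (1 + s * Gz ζ x y)) :=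
    continuous_const.mul (hpc.log fun p => (hpos p.1 p.2).ne')
  have c2 : Continuous (Function.uncurry fun x y => (1 / 2) * (1 - 1 / (1 + s * Gz ζ x y))) :=
    continuous_const.mul (continuous_const.sub
      (continuous_const.div hpc fun p => (hpos p.1 p.2).ne'))
  have key : Is s ζ - Ks s ζ = (1 / (4 * π ^ 2)) * ∫ x in (-π)..π, ∫ y in (-π)..π,
      (1 / 2) * (1 - 1 / (1 + s * Gz ζ x y)) := by
    unfold Is Ks
    rw [aux_int_sub _ _ c1 c2]
    ring
  have hq : (0 : ℝ) ≤ 1 / (4 * π ^ 2) := by positivity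
  rw [key]
  constructor
  · rw [← aux_const ((1 / 2) * (1 - 1 / (1 + s * m)))]
    apply mul_le_mul_of_nonneg_left _ hq
    apply aux_int_mono _ _ continuous_const c2
    intro x y
    have : 1 / (1 + s * Gz ζ x y) ≤ 1 / (1 + s * m) :=
      one_div_le_one_div_of_le (by positivity)
        (by have := mul_le_mul_of_nonneg_left (hG x y) hs.le; linarith)
    linarith
  · refine le_of_le_of_eq ?_ (aux_const (1 / 2))
    apply mul_le_mul_of_nonneg_left _ hq
    apply aux_int_mono _ _ c2 continuous_const
    intro x y
    have : 0 < 1 / (1 + s * Gz ζ x y) := one_div_pos.mpr (hpos x y)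
    linarith

/-- For every `SNR > 0` and `ζ ∈ [0,1/4)` the per-node KLI is strictly smaller
than the per-node MI, and for fixed `ζ` their difference converges to `1/2` as
`SNR → ∞`. -/
theorem KLI_lt_MI_and_gap_tendsto_half :
    (∀ snr : ℝ, 0 < snr → ∀ ζ ∈ Set.Ico (0 : ℝ) (1 / 4), Ks snr ζ < Is snr ζ) ∧
    (∀ ζ ∈ Set.Ico (0 : ℝ) (1 / 4),
      Tendsto (fun snr : ℝ => Is snr ζ - Ks snr ζ) atTop (nhds (1 / 2))) := by
  constructor
  · intro s hs ζ h
    obtain ⟨m, hm, H⟩ := aux_gap ζ h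
    have h1 := (H s hs).1
    have h2 : 1 / (1 + s * m) < 1 := by
      rw [div_lt_one (by positivity)]
      have := mul_pos hs hm
      linarith
    linarith
  · intro ζ h
    obtain ⟨m, hm, H⟩ := aux_gap ζ h
    have hl : Tendsto (fun s : ℝ => (1 / 2) * (1 - 1 / (1 + s * m))) atTop (nhds (1 / 2)) := by
      have h1 : Tendsto (fun s : ℝ => 1 + s * m) atTop atTop :=
        tendsto_atTop_add_const_left _ _ (tendsto_id.atTop_mul_const hm)
      have h2 : Tendsto (fun s : ℝ => 1 / (1 + s * m)) atTop (nhds 0) := by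
        simp only [one_div]
        exact h1.inv_tendsto_atTop
      simpa using (h2.const_sub 1).const_mul (1 / 2 : ℝ)
    refine tendsto_of_tendsto_of_tendsto_of_le_of_le' hl tendsto_const_nhds ?_ ?_
    · filter_upwards [eventually_gt_atTop 0] with s hs using (H s hs).1
    · filter_upwards [eventually_gt_atTop 0] with s hs using (H s hs).2
end

section
/- In the perfectly correlated limit, both asymptotic per-node information measures of the hidden SFCAR model vanish: for every fixed SNR > 0, lim_{ζ→(1/4)⁻} 𝒦ₛ(SNR, ζ) = 0 and lim_{ζ→(1/4)⁻} ℐₛ(SNR, ζ) = 0. -/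
open Real MeasureTheory Filter

theorem aux_K_lower (k : ℝ) (h0 : 0 ≤ k) (h1 : k < 1) :
    Real.log ((√(1 - k ^ 2) + π / 2) / √(1 - k ^ 2)) ≤ ellipticK k := by
  have hk : 0 < 1 - k ^ 2 := by nlinarith
  have ha : 0 < √(1 - k ^ 2) := Real.sqrt_pos.mpr hk
  have hsq : √(1 - k ^ 2) ^ 2 = 1 - k ^ 2 := Real.sq_sqrt hk.le
  set a := √(1 - k ^ 2) with hadef
  have hpi := Real.pi_pos
  have e : ∫ t in (0 : ℝ)..(π / 2), (a + π / 2 - t)⁻¹ = Real.log ((a + π / 2) / a) := by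
    rw [intervalIntegral.integral_comp_sub_left (fun x => x⁻¹) (a + π / 2)]
    rw [integral_inv_of_pos (by linarith) (by linarith)]
    congr 1
    congr 1 <;> ring
  have hpos : ∀ t : ℝ, 0 < 1 - k ^ 2 * Real.sin t ^ 2 := by
    intro t
    nlinarith [Real.sin_sq_le_one t, sq_nonneg k, sq_nonneg (Real.sin t)]
  rw [← e, ellipticK]
  apply intervalIntegral.integral_mono_on (by linarith)
  · apply ContinuousOn.intervalIntegrable
    rw [Set.uIcc_of_le (by linarith)]
    apply ContinuousOn.inv₀ (by fun_prop)
    intro t ht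
    have := ht.2
    linarith
  · apply Continuous.intervalIntegrable
    apply Continuous.rpow_const (by fun_prop)
    intro t
    exact Or.inl (hpos t).ne'
  · intro t ht
    have h2 := ht.2
    have hc : Real.cos t ≤ π / 2 - t := by
      rw [← Real.sin_pi_div_two_sub]
      exact Real.sin_le (by linarith)
    have hc0 : 0 ≤ Real.cos t := Real.cos_nonneg_of_mem_Icc ⟨by linarith [ht.1], h2⟩
    rw [Real.rpow_neg (hpos t).le, ← Real.sqrt_eq_rpow]
    apply inv_anti₀ (Real.sqrt_pos.mpr (hpos t))
    apply Real.sqrt_le_iff.mpr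
    refine ⟨by linarith, ?_⟩
    have hs := Real.sin_sq_add_cos_sq t
    have : a ^ 2 + Real.cos t ^ 2 ≤ (a + π / 2 - t) ^ 2 := by nlinarith
    nlinarith [sq_nonneg (Real.cos t)]

theorem aux_K_tendsto :
    Tendsto (fun ζ : ℝ => ellipticK (4 * ζ)) (nhdsWithin (1 / 4) (Set.Ico 0 (1 / 4))) atTop := by
  have hmem : ∀ᶠ ζ : ℝ in nhdsWithin (1 / 4) (Set.Ico 0 (1 / 4)), ζ ∈ Set.Ico (0 : ℝ) (1 / 4) :=
    self_mem_nhdsWithin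
  have hpi := Real.pi_pos
  have hs : Tendsto (fun ζ : ℝ => √(1 - (4 * ζ) ^ 2)) (nhdsWithin (1 / 4) (Set.Ico 0 (1 / 4)))
      (nhdsWithin 0 (Set.Ioi 0)) := by
    apply tendsto_nhdsWithin_iff.mpr
    constructor
    · have : Continuous (fun ζ : ℝ => √(1 - (4 * ζ) ^ 2)) := by fun_prop
      have h := (this.tendsto (1 / 4)).mono_left
        (nhdsWithin_le_nhds (s := Set.Ico (0 : ℝ) (1 / 4)))
      norm_num at h
      norm_num
      exact h
    · filter_upwards [hmem] with ζ hζ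
      apply Real.sqrt_pos.mpr
      nlinarith [hζ.1, hζ.2]
  have h1 : Tendsto (fun ζ : ℝ => Real.log ((π / 2) * (√(1 - (4 * ζ) ^ 2))⁻¹))
      (nhdsWithin (1 / 4) (Set.Ico 0 (1 / 4))) atTop :=
    Real.tendsto_log_atTop.comp
      ((tendsto_inv_nhdsGT_zero.comp hs).const_mul_atTop (by positivity))
  apply tendsto_atTop_mono' _ _ h1
  filter_upwards [hmem] with ζ hζ
  have hp : 0 < √(1 - (4 * ζ) ^ 2) := by
    apply Real.sqrt_pos.mpr
    nlinarith [hζ.1, hζ.2]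
  refine le_trans ?_ (aux_K_lower (4 * ζ) (by linarith [hζ.1]) (by linarith [hζ.2]))
  apply Real.log_le_log (by positivity)
  rw [div_eq_mul_inv (_ + _)]
  gcongr
  linarith

theorem aux_int : IntervalIntegrable (fun x : ℝ => |x| ^ (-(1 / 2) : ℝ)) volume (-π) π := by
  have hpi := Real.pi_pos
  have h1 : IntervalIntegrable (fun x : ℝ => |x| ^ (-(1 / 2) : ℝ)) volume 0 π := by
    have := intervalIntegral.intervalIntegrable_rpow' (a := 0) (b := π)
      (r := (-(1 / 2) : ℝ)) (by norm_num)
    apply this.congr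
    intro x hx
    rw [Set.uIoc_of_le hpi.le] at hx
    simp only [abs_of_pos hx.1]
  have h2 := (IntervalIntegrable.iff_comp_neg (f := fun x : ℝ => |x| ^ (-(1 / 2) : ℝ))
    (a := 0) (b := π)).mp h1
  simp only [abs_neg, neg_zero] at h2
  exact h2.symm.trans h1

theorem aux_G (snr ζ x y : ℝ) (hsnr : 0 < snr) (h0 : 1 / 8 ≤ ζ) (h1 : ζ < 1 / 4)
    (hK : 0 < ellipticK (4 * ζ)) (hx : |x| ≤ π) (hx0 : x ≠ 0) :
    0 ≤ snr * Gz ζ x y ∧ Real.log (1 + snr * Gz ζ x y) ≤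
      4 * ((snr * π ^ 3 / ellipticK (4 * ζ)) ^ (1 / 4 : ℝ) * |x| ^ (-(1 / 2) : ℝ)) := by
  have hpi := Real.pi_pos
  have hx2 : 0 < x ^ 2 := by positivity
  have hax : 0 < |x| := abs_pos.mpr hx0
  have hD : x ^ 2 / (2 * π ^ 2) ≤ Dz ζ x y := by
    have hc := Real.cos_le_one_sub_mul_cos_sq hx
    have hy := Real.cos_le_one y
    have hq : x ^ 2 / (2 * π ^ 2) = (1 / 4) * (2 / π ^ 2 * x ^ 2) := by
      field_simp; norm_num
    have hq0 : 0 ≤ 2 / π ^ 2 * x ^ 2 := by positivity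
    rw [hq, Dz]
    nlinarith
  have hD0 : 0 < Dz ζ x y := lt_of_lt_of_le (by positivity) hD
  have hG0 : 0 ≤ snr * Gz ζ x y := by
    rw [Gz]; positivity
  refine ⟨hG0, ?_⟩
  set K := ellipticK (4 * ζ) with hKdef
  set w := (snr * π ^ 3 / K) ^ (1 / 4 : ℝ) * |x| ^ (-(1 / 2) : ℝ) with hw
  have hw0 : 0 ≤ w := by positivity
  have hw4 : w ^ 4 = (snr * π ^ 3 / K) / x ^ 2 := by
    rw [hw, mul_pow, ← Real.rpow_mul_natCast (by positivity), ← Real.rpow_mul_natCast hax.le]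
    norm_num
    rw [div_eq_mul_inv (_ / _)]
  have hG : snr * Gz ζ x y ≤ w ^ 4 := by
    rw [hw4, Gz, ← hKdef]
    calc snr * (1 / (2 / π * K * Dz ζ x y))
        ≤ snr * (1 / (2 / π * K * (x ^ 2 / (2 * π ^ 2)))) := by gcongr
      _ = _ := by field_simp
  calc Real.log (1 + snr * Gz ζ x y) ≤ Real.log ((1 + w) ^ 4) := by
        apply Real.log_le_log (by linarith)
        nlinarith [pow_nonneg hw0 2, pow_nonneg hw0 3]
    _ = 4 * Real.log (1 + w) := by rw [Real.log_pow]; norm_num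
    _ ≤ 4 * w := by
        have := Real.log_le_sub_one_of_pos (x := 1 + w) (by linarith)
        linarith

theorem aux_main (snr : ℝ) (hsnr : 0 < snr) (F : ℝ → ℝ)
    (hF : ∀ z, 0 ≤ z → |F z| ≤ Real.log (1 + z)) :
    Tendsto (fun ζ : ℝ => (1 / (4 * π ^ 2)) * ∫ ω₁ in (-π)..π, ∫ ω₂ in (-π)..π,
      F (snr * Gz ζ ω₁ ω₂)) (nhdsWithin (1 / 4) (Set.Ico 0 (1 / 4))) (nhds 0) := by
  have hpi := Real.pi_pos
  suffices h : Tendsto (fun ζ : ℝ => ∫ ω₁ in (-π)..π, ∫ ω₂ in (-π)..π,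
      F (snr * Gz ζ ω₁ ω₂)) (nhdsWithin (1 / 4) (Set.Ico 0 (1 / 4))) (nhds 0) by
    have h2 := h.const_mul (1 / (4 * π ^ 2))
    rwa [mul_zero (1 / (4 * π ^ 2))] at h2
  set J := ∫ x in (-π)..π, |x| ^ (-(1 / 2) : ℝ) with hJ
  have hlim : Tendsto (fun ζ : ℝ => (4 * (snr * π ^ 3 / ellipticK (4 * ζ)) ^ (1 / 4 : ℝ)
      * (2 * π)) * J) (nhdsWithin (1 / 4) (Set.Ico 0 (1 / 4))) (nhds 0) := by
    have h := (aux_K_tendsto.const_div_atTop (snr * π ^ 3)).rpow_const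
      (p := (1 / 4 : ℝ)) (Or.inr (by norm_num))
    rw [Real.zero_rpow (by norm_num)] at h
    have h2 := ((h.const_mul 4).mul_const (2 * π)).mul_const J
    simpa using h2
  apply squeeze_zero_norm' _ hlim
  have hmem : ∀ᶠ ζ : ℝ in nhdsWithin (1 / 4) (Set.Ico 0 (1 / 4)), ζ ∈ Set.Ico (0 : ℝ) (1 / 4) :=
    self_mem_nhdsWithin
  have h8 : ∀ᶠ ζ : ℝ in nhdsWithin (1 / 4) (Set.Ico 0 (1 / 4)), (1 / 8 : ℝ) ≤ ζ :=
    nhdsWithin_le_nhds (Ici_mem_nhds (by norm_num))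
  filter_upwards [hmem, h8, aux_K_tendsto.eventually_gt_atTop 0] with ζ hζ hζ8 hK
  rw [hJ, ← intervalIntegral.integral_const_mul]
  apply intervalIntegral.norm_integral_le_of_norm_le (by linarith) _ (aux_int.const_mul _)
  have hne : ∀ᵐ x : ℝ, x ≠ 0 := by simp [ae_iff]
  filter_upwards [hne] with x hx0 hx
  have hxa : |x| ≤ π := abs_le.mpr ⟨hx.1.le, hx.2⟩
  have := intervalIntegral.norm_integral_le_of_norm_le_const (a := -π) (b := π)
    (f := fun y => F (snr * Gz ζ x y))
    (C := 4 * ((snr * π ^ 3 / ellipticK (4 * ζ)) ^ (1 / 4 : ℝ) * |x| ^ (-(1 / 2) : ℝ)))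
    (fun y _ => by
      obtain ⟨ha, hb⟩ := aux_G snr ζ x y hsnr hζ8 hζ.2 hK hxa hx0
      exact (hF _ ha).trans hb)
  refine this.trans (le_of_eq ?_)
  rw [abs_of_pos (a := π - -π) (by linarith)]
  ring

/-- In the perfectly correlated limit `ζ → (1/4)⁻`, both per-node information
measures of the hidden SFCAR model vanish. -/
theorem SFCAR_info_vanishes_at_perfect_correlation (snr : ℝ) (hsnr : 0 < snr) :
    Tendsto (fun ζ : ℝ => Ks snr ζ) (nhdsWithin (1 / 4) (Set.Ico 0 (1 / 4))) (nhds 0) ∧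
    Tendsto (fun ζ : ℝ => Is snr ζ) (nhdsWithin (1 / 4) (Set.Ico 0 (1 / 4))) (nhds 0) := by
  constructor
  · apply aux_main snr hsnr
      (fun z => (1 / 2) * Real.log (1 + z) - (1 / 2) * (1 - 1 / (1 + z)))
    intro z hz
    have h1 := Real.one_sub_inv_le_log_of_pos (x := 1 + z) (by linarith)
    have h2 : (1 + z)⁻¹ ≤ 1 := inv_le_one_of_one_le₀ (by linarith)
    rw [one_div (1 + z), abs_le]
    constructor <;> linarith
  · apply aux_main snr hsnr (fun z => (1 / 2) * Real.log (1 + z))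
    intro z hz
    have h1 := Real.log_nonneg (x := 1 + z) (by linarith)
    rw [abs_le]
    constructor <;> linarith
end

section
/- For each fixed edge dependence factor ζ ∈ [0, 1/4), the map SNR ↦ 𝒦ₛ(SNR, ζ) is continuous on [0,∞) and strictly increasing on (0,∞), and the map SNR ↦ ℐₛ(SNR, ζ) is likewise continuous on [0,∞) and strictly increasing on (0,∞). -/
open Real MeasureTheory Filter

lemma ellipticK_pos_aux (k : ℝ) (h0 : 0 ≤ k) (h1 : k < 1) : 0 < ellipticK k := by
  have hp : ∀ t : ℝ, 0 < 1 - k ^ 2 * Real.sin t ^ 2 := by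
    intro t
    have h2 : Real.sin t ^ 2 ≤ 1 := Real.sin_sq_le_one t
    have h3 : k ^ 2 < 1 := by nlinarith
    nlinarith [sq_nonneg k, sq_nonneg (Real.sin t)]
  unfold ellipticK
  apply intervalIntegral.intervalIntegral_pos_of_pos
  · apply Continuous.intervalIntegrable
    apply Continuous.rpow_const (by fun_prop)
    intro t
    exact Or.inl (hp t).ne'
  · intro t
    exact Real.rpow_pos_of_pos (hp t) _
  · positivity

lemma Dz_pos_aux (ζ : ℝ) (hζ : ζ ∈ Set.Ico (0 : ℝ) (1 / 4)) (a b : ℝ) : 0 < Dz ζ a b := by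
  unfold Dz
  obtain ⟨h0, h1⟩ := hζ
  nlinarith [Real.cos_le_one a, Real.cos_le_one b]

lemma Gz_pos_aux (ζ : ℝ) (hζ : ζ ∈ Set.Ico (0 : ℝ) (1 / 4)) (a b : ℝ) : 0 < Gz ζ a b := by
  unfold Gz
  have h1 := Dz_pos_aux ζ hζ a b
  have h2 := ellipticK_pos_aux (4 * ζ) (by linarith [hζ.1]) (by linarith [hζ.2])
  positivity

lemma Gz_cont_aux (ζ : ℝ) (hζ : ζ ∈ Set.Ico (0 : ℝ) (1 / 4)) :
    Continuous (fun p : ℝ × ℝ => Gz ζ p.1 p.2) := by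
  unfold Gz
  have h2 := ellipticK_pos_aux (4 * ζ) (by linarith [hζ.1]) (by linarith [hζ.2])
  apply Continuous.div continuous_const
  · unfold Dz
    fun_prop
  · intro p
    have h1 := Dz_pos_aux ζ hζ p.1 p.2
    positivity

lemma general_aux (G : ℝ → ℝ → ℝ) (hG : Continuous (fun p : ℝ × ℝ => G p.1 p.2))
    (hpos : ∀ a b, 0 < G a b) (f : ℝ → ℝ) (hf : ContinuousOn f (Set.Ici 1))
    (hm : StrictMonoOn f (Set.Ici 1)) (c : ℝ) (hc : 0 < c) :
    ContinuousOn (fun s : ℝ => c * ∫ a in (-π)..π, ∫ b in (-π)..π, f (1 + s * G a b))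
      (Set.Ici 0) ∧
    StrictMonoOn (fun s : ℝ => c * ∫ a in (-π)..π, ∫ b in (-π)..π, f (1 + s * G a b))
      (Set.Ioi 0) := by
  have hpi : -π < π := by linarith [Real.pi_pos]
  obtain ⟨h, hh⟩ : ∃ h : ℝ → ℝ, h = fun x => f (max 1 x) := ⟨_, rfl⟩
  have hcont : Continuous h := by
    rw [hh]
    exact hf.comp_continuous (by fun_prop) (fun x => le_max_left 1 x)
  have heq : ∀ s, 0 ≤ s → ∀ a b, f (1 + s * G a b) = h (1 + s * G a b) := by
    intro s hs a b
    rw [hh]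
    have : 0 ≤ s * G a b := mul_nonneg hs (hpos a b).le
    simp only
    rw [max_eq_right (by linarith)]
  have hj : Continuous (fun p : (ℝ × ℝ) × ℝ => h (1 + p.1.1 * G p.1.2 p.2)) := by
    apply hcont.comp
    have : Continuous (fun p : (ℝ × ℝ) × ℝ => G p.1.2 p.2) :=
      hG.comp (by fun_prop : Continuous (fun p : (ℝ × ℝ) × ℝ => (p.1.2, p.2)))
    fun_prop
  have hin : Continuous (fun q : ℝ × ℝ => ∫ b in (-π)..π, h (1 + q.1 * G q.2 b)) :=
    intervalIntegral.continuous_parametric_intervalIntegral_of_continuous'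
      (f := fun (q : ℝ × ℝ) b => h (1 + q.1 * G q.2 b)) hj _ _
  have hout : Continuous (fun s : ℝ => ∫ a in (-π)..π, ∫ b in (-π)..π, h (1 + s * G a b)) :=
    intervalIntegral.continuous_parametric_intervalIntegral_of_continuous'
      (f := fun (s : ℝ) a => ∫ b in (-π)..π, h (1 + s * G a b)) hin _ _
  have hEq : Set.EqOn (fun s : ℝ => c * ∫ a in (-π)..π, ∫ b in (-π)..π, f (1 + s * G a b))
      (fun s : ℝ => c * ∫ a in (-π)..π, ∫ b in (-π)..π, h (1 + s * G a b)) (Set.Ici 0) := by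
    intro s hs
    simp only [heq s hs]
  refine ⟨(continuous_const.mul hout).continuousOn.congr hEq, ?_⟩
  intro s hs t ht hst
  have hs' : (0 : ℝ) < s := hs
  have ht' : (0 : ℝ) < t := ht
  rw [hEq hs'.le, hEq ht'.le]
  simp only
  apply mul_lt_mul_of_pos_left _ hc
  have hlt : ∀ a b, h (1 + s * G a b) < h (1 + t * G a b) := by
    intro a b
    rw [← heq s hs'.le, ← heq t ht'.le]
    have h1 : 0 < s * G a b := mul_pos hs' (hpos a b)
    have h2 : s * G a b < t * G a b := mul_lt_mul_of_pos_right hst (hpos a b)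
    apply hm
    · simp only [Set.mem_Ici]; linarith
    · simp only [Set.mem_Ici]; linarith
    · linarith
  have hca : ∀ s, Continuous (fun a => ∫ b in (-π)..π, h (1 + s * G a b)) := fun s =>
    hin.comp (by fun_prop : Continuous (fun a : ℝ => (s, a)))
  have hcb : ∀ s a, Continuous (fun b => h (1 + s * G a b)) := fun s a =>
    hj.comp (by fun_prop : Continuous (fun b : ℝ => ((s, a), b)))
  have hinlt : ∀ a, ∫ b in (-π)..π, h (1 + s * G a b) < ∫ b in (-π)..π, h (1 + t * G a b) := by
    intro a
    exact intervalIntegral.integral_lt_integral_of_continuousOn_of_le_of_exists_lt hpi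
      (hcb s a).continuousOn (hcb t a).continuousOn (fun b _ => (hlt a b).le)
      ⟨π, ⟨hpi.le, le_rfl⟩, hlt a π⟩
  exact intervalIntegral.integral_lt_integral_of_continuousOn_of_le_of_exists_lt hpi
      (hca s).continuousOn (hca t).continuousOn (fun a _ => (hinlt a).le)
      ⟨π, ⟨hpi.le, le_rfl⟩, hinlt π⟩

lemma contK_aux : ContinuousOn
    (fun x : ℝ => (1 / 2) * Real.log x - (1 / 2) * (1 - 1 / x)) (Set.Ici 1) := by
  have hne : ∀ x ∈ Set.Ici (1 : ℝ), x ≠ 0 := fun x hx => by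
    have : (1 : ℝ) ≤ x := hx
    positivity
  exact (continuousOn_const.mul (continuousOn_id.log hne)).sub
    (continuousOn_const.mul (continuousOn_const.sub (continuousOn_const.div continuousOn_id hne)))

lemma monoK_aux : StrictMonoOn
    (fun x : ℝ => (1 / 2) * Real.log x - (1 / 2) * (1 - 1 / x)) (Set.Ici 1) := by
  intro x hx y hy hxy
  have hx1 : (1 : ℝ) ≤ x := hx
  have hx0 : 0 < x := by linarith
  have hy0 : 0 < y := by linarith
  have h1 : Real.log (x / y) < x / y - 1 := by
    apply Real.log_lt_sub_one_of_pos (by positivity)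
    exact ((div_lt_one hy0).2 hxy).ne
  rw [Real.log_div hx0.ne' hy0.ne'] at h1
  have h2 : 1 / x - 1 / y ≤ 1 - x / y := by
    have : 1 - x / y - (1 / x - 1 / y) = (y - x) * (x - 1) / (x * y) := by
      field_simp
    have h3 : 0 ≤ (y - x) * (x - 1) / (x * y) :=
      div_nonneg (mul_nonneg (by linarith) (by linarith)) (by positivity)
    linarith
  simp only
  linarith

/-- For fixed `ζ ∈ [0,1/4)`, `SNR ↦ 𝒦ₛ(SNR,ζ)` and `SNR ↦ ℐₛ(SNR,ζ)` are
continuous on `[0,∞)` and strictly increasing on `(0,∞)`. -/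
theorem SFCAR_info_continuous_strictMono (ζ : ℝ) (hζ : ζ ∈ Set.Ico (0 : ℝ) (1 / 4)) :
    ContinuousOn (fun snr : ℝ => Ks snr ζ) (Set.Ici 0) ∧
    StrictMonoOn (fun snr : ℝ => Ks snr ζ) (Set.Ioi 0) ∧
    ContinuousOn (fun snr : ℝ => Is snr ζ) (Set.Ici 0) ∧
    StrictMonoOn (fun snr : ℝ => Is snr ζ) (Set.Ioi 0) := by
  have hc : (0 : ℝ) < 1 / (4 * π ^ 2) := by positivity
  have hG := Gz_cont_aux ζ hζ
  have hp := Gz_pos_aux ζ hζ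
  have hA := general_aux (Gz ζ) hG hp _ contK_aux monoK_aux _ hc
  have hB := general_aux (Gz ζ) hG hp (fun x : ℝ => (1 / 2) * Real.log x)
    (continuousOn_const.mul (continuousOn_id.log (fun x hx => by
      have : (1 : ℝ) ≤ x := hx
      simp only [id]
      positivity)))
    (by
      intro x hx y hy hxy
      have hx1 : (1 : ℝ) ≤ x := hx
      have := Real.log_lt_log (by linarith) hxy
      simp only
      linarith) _ hc
  exact ⟨hA.1, hA.2, hB.1, hB.2⟩
end

section
/- At low SNR the per-node Kullback–Leibler information of the hidden SFCAR model decays quadratically: for each fixed ζ ∈ [0, 1/4), 𝒦ₛ(SNR, ζ) = c₃ · SNR² + o(SNR²) as SNR → 0⁺, i.e. lim_{SNR→0⁺} 𝒦ₛ(SNR, ζ)/SNR² = c₃, where c₃ = (1/(2⁶ K(4ζ)²)) ∫_{−π}^{π} ∫_{−π}^{π} (1 − 2ζ cos ω₁ − 2ζ cos ω₂)^{−2} dω₁ dω₂. -/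
open Real MeasureTheory Filter

lemma phi_hasDeriv (x : ℝ) (hx : 0 ≤ x) :
    HasDerivAt (fun x : ℝ => (1 / 2) * Real.log (1 + x) - (1 / 2) * (1 - 1 / (1 + x)))
      (x / (2 * (1 + x) ^ 2)) x := by
  have h1 : (1 + x) ≠ 0 := by positivity
  have ha : HasDerivAt (fun x : ℝ => 1 + x) 1 x := (hasDerivAt_id x).const_add 1
  have hl := (ha.log h1).const_mul (1 / 2 : ℝ)
  have hi := ((ha.inv h1).const_sub 1).const_mul (1 / 2 : ℝ)
  have := hl.sub hi
  simp only [one_div] at this ⊢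
  refine this.congr_deriv ?_
  field_simp
  ring

lemma phi_upper (x : ℝ) (hx : 0 ≤ x) :
    (1 / 2) * Real.log (1 + x) - (1 / 2) * (1 - 1 / (1 + x)) ≤ x ^ 2 / 4 := by
  have hd : ∀ y : ℝ, 0 ≤ y → HasDerivAt (fun x : ℝ => x ^ 2 / 4 -
      ((1 / 2) * Real.log (1 + x) - (1 / 2) * (1 - 1 / (1 + x))))
      (y / 2 - y / (2 * (1 + y) ^ 2)) y := by
    intro y hy
    have h := (((hasDerivAt_pow 2 y).div_const 4).sub (phi_hasDeriv y hy))
    refine h.congr_deriv ?_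
    norm_num
    ring
  have hm := monotoneOn_of_deriv_nonneg (convex_Ici (0 : ℝ))
    (fun y hy => (hd y hy).continuousAt.continuousWithinAt)
    (fun y hy => (hd y (interior_subset hy)).differentiableAt.differentiableWithinAt)
    (fun y hy => by
      have hy0 : (0 : ℝ) ≤ y := interior_subset hy
      rw [(hd y hy0).deriv, sub_nonneg]
      apply div_le_div_of_nonneg_left hy0 (by norm_num)
      nlinarith)
  have := hm (Set.mem_Ici.2 le_rfl) (Set.mem_Ici.2 hx) hx
  norm_num at this
  norm_num
  linarith

lemma phi_lower (x : ℝ) (hx : 0 ≤ x) :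
    x ^ 2 / 4 - x ^ 3 / 3 ≤ (1 / 2) * Real.log (1 + x) - (1 / 2) * (1 - 1 / (1 + x)) := by
  have hd : ∀ y : ℝ, 0 ≤ y → HasDerivAt (fun x : ℝ => 
      ((1 / 2) * Real.log (1 + x) - (1 / 2) * (1 - 1 / (1 + x))) - (x ^ 2 / 4 - x ^ 3 / 3))
      (y / (2 * (1 + y) ^ 2) - (y / 2 - y ^ 2)) y := by
    intro y hy
    have h := ((phi_hasDeriv y hy).sub
      (((hasDerivAt_pow 2 y).div_const 4).sub ((hasDerivAt_pow 3 y).div_const 3)))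
    refine h.congr_deriv ?_
    norm_num
    ring
  have hm := monotoneOn_of_deriv_nonneg (convex_Ici (0 : ℝ))
    (fun y hy => (hd y hy).continuousAt.continuousWithinAt)
    (fun y hy => (hd y (interior_subset hy)).differentiableAt.differentiableWithinAt)
    (fun y hy => by
      have hy0 : (0 : ℝ) ≤ y := interior_subset hy
      rw [(hd y hy0).deriv, sub_nonneg, le_div_iff₀ (by positivity)]
      have : 0 ≤ y ^ 3 := by positivity
      have : 0 ≤ y ^ 4 := by positivity
      nlinarith)
  have := hm (Set.mem_Ici.2 le_rfl) (Set.mem_Ici.2 hx) hx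
  norm_num at this
  norm_num
  linarith

lemma dbl_bound (F H : ℝ → ℝ → ℝ) (hF : Continuous (Function.uncurry F))
    (hH : Continuous (Function.uncurry H)) (C : ℝ) (h : ∀ a b, |F a b - H a b| ≤ C) :
    |(∫ a in (-π)..π, ∫ b in (-π)..π, F a b) - ∫ a in (-π)..π, ∫ b in (-π)..π, H a b|
      ≤ C * (2 * π) * (2 * π) := by
  have cF := intervalIntegral.continuous_parametric_intervalIntegral_of_continuous' (μ := volume)
    hF (-π) π
  have cH := intervalIntegral.continuous_parametric_intervalIntegral_of_continuous' (μ := volume)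
    hH (-π) π
  have e : |π - -π| = 2 * π := by
    rw [abs_of_nonneg] <;> linarith [Real.pi_pos]
  rw [← intervalIntegral.integral_sub (cF.intervalIntegrable _ _) (cH.intervalIntegrable _ _)]
  rw [← Real.norm_eq_abs]
  have := intervalIntegral.norm_integral_le_of_norm_le_const (a := -π) (b := π)
    (f := fun a => (∫ b in (-π)..π, F a b) - ∫ b in (-π)..π, H a b) (C := C * (2 * π)) ?_
  · rwa [e] at this
  intro a _
  have c1 : Continuous (F a) := hF.comp (Continuous.prodMk_right a)
  have c2 : Continuous (H a) := hH.comp (Continuous.prodMk_right a)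
  rw [← intervalIntegral.integral_sub (c1.intervalIntegrable _ _) (c2.intervalIntegrable _ _)]
  rw [← e]
  exact intervalIntegral.norm_integral_le_of_norm_le_const (fun b _ => h a b)

lemma ellipticK_nonneg (k : ℝ) (h : k ^ 2 ≤ 1) : 0 ≤ ellipticK k := by
  unfold ellipticK
  apply intervalIntegral.integral_nonneg (by positivity)
  intro t _
  apply Real.rpow_nonneg
  nlinarith [Real.sin_sq_le_one t, sq_nonneg (Real.sin t), sq_nonneg k]

/-- Low-SNR behavior of the per-node KLI of the hidden SFCAR model:
`𝒦ₛ(SNR,ζ) = c₃·SNR² + o(SNR²)` as `SNR → 0⁺`, with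
`c₃ = (1/(2⁶ K(4ζ)²)) ∬ D_ζ^{-2}`. -/
theorem SFCAR_KLI_low_SNR (ζ : ℝ) (hζ : ζ ∈ Set.Ico (0 : ℝ) (1 / 4)) :
    Tendsto (fun snr : ℝ => Ks snr ζ / snr ^ 2)
      (nhdsWithin 0 (Set.Ioi 0))
      (nhds ((1 / (2 ^ 6 * ellipticK (4 * ζ) ^ 2)) *
        ∫ ω₁ in (-π)..π, ∫ ω₂ in (-π)..π, 1 / (Dz ζ ω₁ ω₂) ^ 2)) := by
  obtain ⟨h0, h1⟩ := hζ
  have hK : 0 ≤ ellipticK (4 * ζ) := ellipticK_nonneg _ (by nlinarith)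
  have hD : ∀ a b, 1 - 4 * ζ ≤ Dz ζ a b := fun a b => by
    unfold Dz
    nlinarith [Real.cos_le_one a, Real.cos_le_one b]
  have hδ : 0 < 1 - 4 * ζ := by linarith
  have hDp : ∀ a b, 0 < Dz ζ a b := fun a b => hδ.trans_le (hD a b)
  have hDc : Continuous (fun p : ℝ × ℝ => Dz ζ p.1 p.2) := by
    unfold Dz; fun_prop
  obtain ⟨c, hc⟩ : ∃ c, c = π / (2 * ellipticK (4 * ζ)) := ⟨_, rfl⟩
  have hc0 : 0 ≤ c := by rw [hc]; positivity
  have hG : ∀ a b, Gz ζ a b = c * (1 / Dz ζ a b) := fun a b => by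
    rw [Gz, hc]; simp only [div_eq_mul_inv, mul_inv, inv_inv]; ring
  have hGc : Continuous (fun p : ℝ × ℝ => Gz ζ p.1 p.2) := by
    simp only [hG]
    exact continuous_const.mul (continuous_const.div hDc (fun p => (hDp _ _).ne'))
  have hG0 : ∀ a b, 0 ≤ Gz ζ a b := fun a b => by
    rw [hG]; have := hDp a b; positivity
  obtain ⟨M, hM⟩ : ∃ M, M = c * (1 / (1 - 4 * ζ)) := ⟨_, rfl⟩
  have hGM : ∀ a b, Gz ζ a b ≤ M := fun a b => by
    rw [hG, hM]
    exact mul_le_mul_of_nonneg_left (one_div_le_one_div_of_le hδ (hD a b)) hc0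
  have hlim : (1 / (2 ^ 6 * ellipticK (4 * ζ) ^ 2)) *
        (∫ ω₁ in (-π)..π, ∫ ω₂ in (-π)..π, 1 / (Dz ζ ω₁ ω₂) ^ 2)
      = (1 / (4 * π ^ 2)) * ∫ a in (-π)..π, ∫ b in (-π)..π, Gz ζ a b ^ 2 / 4 := by
    have : ∀ a b, Gz ζ a b ^ 2 / 4 = c ^ 2 / 4 * (1 / (Dz ζ a b) ^ 2) := fun a b => by
      rw [hG]; ring
    simp only [this, intervalIntegral.integral_const_mul]
    rw [← mul_assoc]
    congr 1
    rw [hc]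
    have := Real.pi_ne_zero
    simp only [div_pow, mul_pow, div_eq_mul_inv, mul_inv]
    field_simp
    norm_num
  rw [hlim]
  rw [tendsto_iff_dist_tendsto_zero]
  have hz : Tendsto (fun s : ℝ => 1 / (4 * π ^ 2) * ((s * M ^ 3 / 3) * (2 * π) * (2 * π)))
      (nhdsWithin 0 (Set.Ioi 0)) (nhds 0) := by
    have : Continuous (fun s : ℝ => 1 / (4 * π ^ 2) * ((s * M ^ 3 / 3) * (2 * π) * (2 * π))) := by
      fun_prop
    have := this.tendsto 0
    simp only [zero_mul, zero_div, mul_zero] at this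
    exact this.mono_left nhdsWithin_le_nhds
  refine squeeze_zero' (Eventually.of_forall fun _ => dist_nonneg) ?_ hz
  filter_upwards [self_mem_nhdsWithin] with s hs
  have hs : 0 < s := hs
  have hp : ∀ a b, 0 ≤ s * Gz ζ a b := fun a b => mul_nonneg hs.le (hG0 a b)
  have hKs : Ks s ζ / s ^ 2 = (1 / (4 * π ^ 2)) * ∫ a in (-π)..π, ∫ b in (-π)..π,
    ((1 / 2) * Real.log (1 + s * Gz ζ a b) -
      (1 / 2) * (1 - 1 / (1 + s * Gz ζ a b))) / s ^ 2 := by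
    simp only [intervalIntegral.integral_div]
    rw [Ks, mul_div_assoc]
  rw [hKs, Real.dist_eq, ← mul_sub, abs_mul, abs_of_nonneg (by positivity : 0 ≤ 1 / (4 * π ^ 2))]
  refine mul_le_mul_of_nonneg_left ?_ (by positivity)
  apply dbl_bound
  · have hx : Continuous (fun p : ℝ × ℝ => 1 + s * Gz ζ p.1 p.2) :=
      continuous_const.add (continuous_const.mul hGc)
    have hx0 : ∀ p : ℝ × ℝ, 1 + s * Gz ζ p.1 p.2 ≠ 0 := fun p => by
      have := hp p.1 p.2; positivity
    exact ((continuous_const.mul (hx.log hx0)).sub (continuous_const.mul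
      (continuous_const.sub (continuous_const.div hx hx0)))).div_const _
  · exact (hGc.pow 2).div_const _
  · intro a b
    have u := phi_upper _ (hp a b)
    have l := phi_lower _ (hp a b)
    have g3 : Gz ζ a b ^ 3 ≤ M ^ 3 := pow_le_pow_left₀ (hG0 a b) (hGM a b) 3
    have g30 : 0 ≤ Gz ζ a b ^ 3 := pow_nonneg (hG0 a b) 3
    generalize (1 / 2) * Real.log (1 + s * Gz ζ a b) -
      (1 / 2) * (1 - 1 / (1 + s * Gz ζ a b)) = P at u l ⊢
    have hs2 : 0 < s ^ 2 := by positivity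
    have hs3 : 0 < s ^ 3 := by positivity
    have k := mul_le_mul_of_nonneg_left g3 hs3.le
    have k0 := mul_nonneg hs3.le g30
    rw [abs_le]
    constructor
    · rw [neg_le_sub_iff_le_add, ← sub_le_iff_le_add, le_div_iff₀ hs2]
      ring_nf at *
      linarith
    · rw [sub_le_iff_le_add, div_le_iff₀ hs2]
      ring_nf at *
      linarith
end

section
/- At low SNR the per-node mutual information of the hidden SFCAR model decays linearly: for each fixed ζ ∈ [0, 1/4), ℐₛ(SNR, ζ) = c₃′ · SNR + o(SNR) as SNR → 0⁺, i.e. lim_{SNR→0⁺} ℐₛ(SNR, ζ)/SNR = c₃′, where c₃′ = (1/(2⁴ π K(4ζ))) ∫_{−π}^{π} ∫_{−π}^{π} (1 − 2ζ cos ω₁ − 2ζ cos ω₂)^{−1} dω₁ dω₂. -/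
open Real MeasureTheory Filter

lemma Dz_lower (ζ : ℝ) (h0 : 0 ≤ ζ) (a b : ℝ) : 1 - 4 * ζ ≤ Dz ζ a b := by
  unfold Dz
  nlinarith [mul_le_mul_of_nonneg_left (Real.cos_le_one a) h0,
    mul_le_mul_of_nonneg_left (Real.cos_le_one b) h0]

lemma ellipticK_nonneg' (ζ : ℝ) (h0 : 0 ≤ ζ) (h1 : ζ < 1 / 4) : 0 ≤ ellipticK (4 * ζ) := by
  unfold ellipticK
  apply intervalIntegral.integral_nonneg (by positivity)
  intro t _
  apply Real.rpow_nonneg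
  have h2 : (4 * ζ) ^ 2 ≤ 1 := by nlinarith
  have h3 := Real.sin_sq_le_one t
  have h4 := sq_nonneg (Real.sin t)
  nlinarith

lemma core_limit (g : ℝ → ℝ → ℝ) (hg : Continuous (Function.uncurry g)) (M : ℝ)
    (h0 : ∀ a b, 0 ≤ g a b) (hM : ∀ a b, g a b ≤ M) :
    Tendsto (fun s : ℝ => ∫ a in (-π)..π, ∫ b in (-π)..π, (1 / 2) * Real.log (1 + s * g a b) / s)
      (nhdsWithin 0 (Set.Ioi 0))
      (nhds (∫ a in (-π)..π, ∫ b in (-π)..π, (1 / 2) * g a b)) := by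
  have hbd : ∀ s : ℝ, 0 < s → ∀ a b, ‖(1 / 2) * Real.log (1 + s * g a b) / s‖ ≤ M := by
    intro s hs a b
    have hx : 0 ≤ s * g a b := mul_nonneg hs.le (h0 a b)
    have hl : 0 ≤ Real.log (1 + s * g a b) := Real.log_nonneg (by linarith)
    have hu : Real.log (1 + s * g a b) ≤ s * g a b := by
      have := Real.log_le_sub_one_of_pos (show 0 < 1 + s * g a b by linarith)
      linarith
    rw [Real.norm_of_nonneg (by positivity), div_le_iff₀ hs]
    nlinarith [mul_le_mul_of_nonneg_left (hM a b) hs.le]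
  have hcont : ∀ s : ℝ, 0 < s → Continuous
      (Function.uncurry fun a b => (1 / 2) * Real.log (1 + s * g a b) / s) := by
    intro s hs
    refine Continuous.div_const (continuous_const.mul (Continuous.log
      (continuous_const.add (continuous_const.mul hg)) ?_)) s
    rintro ⟨a, b⟩
    have hx : 0 ≤ s * g a b := mul_nonneg hs.le (h0 a b)
    change 1 + s * g a b ≠ 0
    linarith
  have hlim : ∀ a b, Tendsto (fun s : ℝ => (1 / 2) * Real.log (1 + s * g a b) / s)
      (nhdsWithin 0 (Set.Ioi 0)) (nhds ((1 / 2) * g a b)) := by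
    intro a b
    have hd : HasDerivAt (fun s : ℝ => (1 / 2) * Real.log (1 + s * g a b))
        ((1 / 2) * g a b) 0 := by
      have h1 : HasDerivAt (fun s : ℝ => 1 + s * g a b) (g a b) 0 := by
        simpa using ((hasDerivAt_id (0 : ℝ)).mul_const (g a b)).const_add 1
      simpa using (h1.log (by simp)).const_mul (1 / 2 : ℝ)
    have h2 := hd.hasDerivWithinAt (s := Set.Ioi 0)
    rw [hasDerivWithinAt_iff_tendsto_slope' (by simp)] at h2
    refine h2.congr fun s => ?_
    simp [slope_def_field]
  refine intervalIntegral.tendsto_integral_filter_of_dominated_convergence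
    (fun _ => M * |π - -π|) ?_ ?_ ?_ ?_
  · filter_upwards [self_mem_nhdsWithin] with s hs
    exact (intervalIntegral.continuous_parametric_intervalIntegral_of_continuous'
      (hcont s hs) _ _).aestronglyMeasurable
  · filter_upwards [self_mem_nhdsWithin] with s hs
    refine Eventually.of_forall fun a _ => ?_
    exact intervalIntegral.norm_integral_le_of_norm_le_const fun b _ => hbd s hs a b
  · exact intervalIntegrable_const
  · refine Eventually.of_forall fun a _ => ?_
    refine intervalIntegral.tendsto_integral_filter_of_dominated_convergence
      (fun _ => M) ?_ ?_ ?_ ?_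
    · filter_upwards [self_mem_nhdsWithin] with s hs
      exact ((hcont s hs).comp (Continuous.prodMk_right a)).aestronglyMeasurable
    · filter_upwards [self_mem_nhdsWithin] with s hs
      exact Eventually.of_forall fun b _ => hbd s hs a b
    · exact intervalIntegrable_const
    · exact Eventually.of_forall fun b _ => hlim a b

/-- Low-SNR behavior of the per-node MI of the hidden SFCAR model:
`ℐₛ(SNR,ζ) = c₃′·SNR + o(SNR)` as `SNR → 0⁺`, with
`c₃′ = (1/(2⁴ π K(4ζ))) ∬ D_ζ^{-1}`. -/
theorem SFCAR_MI_low_SNR (ζ : ℝ) (hζ : ζ ∈ Set.Ico (0 : ℝ) (1 / 4)) :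
    Tendsto (fun snr : ℝ => Is snr ζ / snr)
      (nhdsWithin 0 (Set.Ioi 0))
      (nhds ((1 / (2 ^ 4 * π * ellipticK (4 * ζ))) *
        ∫ ω₁ in (-π)..π, ∫ ω₂ in (-π)..π, 1 / Dz ζ ω₁ ω₂)) := by
  obtain ⟨h0, h1⟩ := hζ
  have hK := ellipticK_nonneg' ζ h0 h1
  have hD : ∀ a b, 0 < Dz ζ a b := fun a b => by linarith [Dz_lower ζ h0 a b]
  set c : ℝ := 1 / ((2 / π) * ellipticK (4 * ζ)) with hc
  have hc0 : 0 ≤ c := by positivity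
  have hG : ∀ a b, Gz ζ a b = c * (1 / Dz ζ a b) := by
    intro a b
    rw [hc, Gz, one_div_mul_one_div]
  have key := core_limit (Gz ζ) (by
      have : Function.uncurry (Gz ζ) = fun p : ℝ × ℝ => c * (1 / Dz ζ p.1 p.2) := by
        ext ⟨a, b⟩; exact hG a b
      rw [this]
      refine continuous_const.mul (continuous_const.div ?_ fun p => (hD _ _).ne')
      unfold Dz
      fun_prop) (c * (1 / (1 - 4 * ζ)))
    (fun a b => by rw [hG]; have := hD a b; positivity)
    (fun a b => by
      rw [hG]
      exact mul_le_mul_of_nonneg_left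
        (one_div_le_one_div_of_le (by linarith) (Dz_lower ζ h0 a b)) hc0)
  have key2 := key.const_mul (1 / (4 * π ^ 2))
  have e1 : (fun snr : ℝ => Is snr ζ / snr) = fun s : ℝ => (1 / (4 * π ^ 2)) *
      ∫ a in (-π)..π, ∫ b in (-π)..π, (1 / 2) * Real.log (1 + s * Gz ζ a b) / s := by
    ext s
    simp only [Is, intervalIntegral.integral_div]
    ring
  rw [e1]
  convert key2 using 2
  simp only [hG, intervalIntegral.integral_const_mul]
  rw [hc]
  simp only [one_div, mul_inv, inv_div, ← mul_assoc]
  congr 1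
  have := Real.pi_pos.ne'
  by_cases hk : ellipticK (4 * ζ) = 0
  · simp [hk]
  · field_simp
    norm_num
end

section
/- For an ad hoc sensor network with fixed node density and fixed per-node sensing energy, the energy efficiency decays as Θ(area^{−1/2}): there exist constants c₁, c₂ > 0 and N such that for all n ≥ N, c₁ · A(n)^{−1/2} ≤ η(n) ≤ c₂ · A(n)^{−1/2}. In particular the total information I_t(n) = n²𝒦 grows linearly in the coverage area A(n), while η(n) → 0 as the area increases. -/
open Filter

lemma aux_base (m j : ℕ) (h : j ≤ m) :
    2 * ∑ i ∈ Finset.range j, |(i : ℤ) - (m : ℤ)| = (j : ℤ) * (2 * m - j + 1) := by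
  induction j with
  | zero => simp
  | succ j ih =>
    have h1 : |(j : ℤ) - m| = m - j := by
      rw [abs_of_nonpos] <;> omega
    rw [Finset.sum_range_succ, mul_add, ih (by omega), h1]
    push_cast
    ring

lemma aux_sum (m k : ℕ) :
    2 * ∑ i ∈ Finset.range (m + k), |(i : ℤ) - (m : ℤ)| =
      (m : ℤ) * (m + 1) + k * (k - 1) := by
  induction k with
  | zero =>
    rw [Nat.add_zero, aux_base m m le_rfl]
    push_cast
    ring
  | succ k ih =>
    have h1 : |((m + k : ℕ) : ℤ) - m| = k := by
      rw [abs_of_nonneg] <;> omega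
    rw [← Nat.add_assoc, Finset.sum_range_succ, mul_add, ih, h1]
    push_cast
    ring

lemma aux_H (n : ℕ) :
    (∑ i ∈ Finset.range n, ∑ j ∈ Finset.range n,
        (|(i : ℤ) - ((n / 2 : ℕ) : ℤ)| + |(j : ℤ) - ((n / 2 : ℕ) : ℤ)|) : ℤ) =
      n * (2 * ∑ i ∈ Finset.range n, |(i : ℤ) - ((n / 2 : ℕ) : ℤ)|) := by
  simp only [Finset.sum_add_distrib, Finset.sum_const, Finset.card_range, nsmul_eq_mul,
    ← Finset.mul_sum]
  ring

lemma aux_bd (n : ℕ) (hn : 2 ≤ n) :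
    (n : ℤ) ^ 2 ≤ 4 * (2 * ∑ i ∈ Finset.range n, |(i : ℤ) - ((n / 2 : ℕ) : ℤ)|) ∧
    (2 * ∑ i ∈ Finset.range n, |(i : ℤ) - ((n / 2 : ℕ) : ℤ)|) ≤ 2 * (n : ℤ) ^ 2 := by
  obtain ⟨m, rfl | rfl⟩ := Nat.even_or_odd' n
  · have h2 : 2 * m / 2 = m := by omega
    have h := aux_sum m m
    rw [← two_mul m] at h
    rw [h2, h]
    push_cast
    constructor <;> nlinarith
  · have h2 : (2 * m + 1) / 2 = m := by omega
    have h := aux_sum m (m + 1)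
    rw [show m + (m + 1) = 2 * m + 1 by ring] at h
    have hm : (1 : ℤ) ≤ m := by omega
    rw [h2, h]
    push_cast
    constructor <;> nlinarith

/-- **Fixed density, fixed per-node sensing energy, growing coverage**
(Theorem 4, first part): the total information grows linearly in the coverage
area, while the energy efficiency `η = I_t/E_t` decays as `Θ(area^{-1/2})`,
and in particular tends to `0`. -/
theorem fixed_density_energy_efficiency
    (Es Ec 𝒦 d : ℝ) (hEs : 0 ≤ Es) (hEc : 0 < Ec) (hK : 0 < 𝒦) (hd : 0 < d)
    (H It Et η A : ℕ → ℝ)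
    (hH : ∀ n : ℕ, H n =
      ((∑ i ∈ Finset.range n, ∑ j ∈ Finset.range n,
        (|(i : ℤ) - ((n / 2 : ℕ) : ℤ)| + |(j : ℤ) - ((n / 2 : ℕ) : ℤ)|) : ℤ) : ℝ))
    (hIt : ∀ n : ℕ, It n = (n : ℝ) ^ 2 * 𝒦)
    (hEt : ∀ n : ℕ, Et n = (n : ℝ) ^ 2 * Es + Ec * H n)
    (hη : ∀ n : ℕ, η n = It n / Et n)
    (hA : ∀ n : ℕ, A n = ((n : ℝ) * d) ^ 2) :
    (∃ c₁ > (0 : ℝ), ∃ c₂ > (0 : ℝ), ∃ N : ℕ, ∀ n ≥ N,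
      c₁ * A n ^ (-(1 / 2) : ℝ) ≤ η n ∧ η n ≤ c₂ * A n ^ (-(1 / 2) : ℝ)) ∧
    (∀ n : ℕ, It n = (𝒦 / d ^ 2) * A n) ∧
    Tendsto η atTop (nhds 0) := by
  have hHb : ∀ n : ℕ, 2 ≤ n → (n : ℝ) ^ 3 ≤ 4 * H n ∧ H n ≤ 2 * (n : ℝ) ^ 3 := by
    intro n hn
    obtain ⟨h1, h2⟩ := aux_bd n hn
    rw [hH, aux_H]
    generalize (2 * ∑ i ∈ Finset.range n, |(i : ℤ) - ((n / 2 : ℕ) : ℤ)|) = S at h1 h2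
    have h1' : (n : ℝ) ^ 2 ≤ 4 * (S : ℝ) := by exact_mod_cast h1
    have h2' : (S : ℝ) ≤ 2 * (n : ℝ) ^ 2 := by exact_mod_cast h2
    have hn0 : (0 : ℝ) ≤ n := Nat.cast_nonneg n
    push_cast
    constructor
    · nlinarith [mul_le_mul_of_nonneg_left h1' hn0]
    · nlinarith [mul_le_mul_of_nonneg_left h2' hn0]
  have hAp : ∀ n : ℕ, A n ^ (-(1 / 2) : ℝ) = ((n : ℝ) * d)⁻¹ := by
    intro n
    have h0 : 0 ≤ (n : ℝ) * d := by positivity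
    rw [hA, Real.rpow_neg (by positivity), ← Real.sqrt_eq_rpow, Real.sqrt_sq h0]
  have key : ∀ n : ℕ, 2 ≤ n → (𝒦 * d / (Es + 2 * Ec)) * ((n : ℝ) * d)⁻¹ ≤ η n ∧
      η n ≤ (4 * 𝒦 * d / Ec) * ((n : ℝ) * d)⁻¹ := by
    intro n hn
    obtain ⟨h1, h2⟩ := hHb n hn
    have hn1 : (1 : ℝ) ≤ n := by exact_mod_cast (by omega : 1 ≤ n)
    have hn0 : (0 : ℝ) < n := by linarith
    have hlo : Ec * (n : ℝ) ^ 3 / 4 ≤ Et n := by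
      rw [hEt]
      have : 0 ≤ (n : ℝ) ^ 2 * Es := by positivity
      nlinarith
    have hhi : Et n ≤ (Es + 2 * Ec) * (n : ℝ) ^ 3 := by
      rw [hEt]
      have h3 : (n : ℝ) ^ 2 * Es ≤ (n : ℝ) ^ 3 * Es := by
        gcongr <;> first | exact hn1 | norm_num
      nlinarith
    have hpos : 0 < Et n := lt_of_lt_of_le (by positivity) hlo
    rw [hη, hIt]
    constructor
    · calc (𝒦 * d / (Es + 2 * Ec)) * ((n : ℝ) * d)⁻¹
          = (n : ℝ) ^ 2 * 𝒦 / ((Es + 2 * Ec) * (n : ℝ) ^ 3) := by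
            have : Es + 2 * Ec ≠ 0 := by positivity
            field_simp
        _ ≤ _ := by gcongr
    · calc (n : ℝ) ^ 2 * 𝒦 / Et n ≤ (n : ℝ) ^ 2 * 𝒦 / (Ec * (n : ℝ) ^ 3 / 4) := by gcongr
        _ = _ := by field_simp
  refine ⟨⟨𝒦 * d / (Es + 2 * Ec), by positivity, 4 * 𝒦 * d / Ec, by positivity, 2, ?_⟩, ?_, ?_⟩
  · intro n hn
    rw [hAp]
    exact key n hn
  · intro n
    rw [hIt, hA]
    field_simp
  · have hlim : ∀ c : ℝ, Tendsto (fun n : ℕ => c * ((n : ℝ) * d)⁻¹) atTop (nhds 0) := by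
      intro c
      have h := (tendsto_inv_atTop_zero.comp
        ((tendsto_natCast_atTop_atTop (R := ℝ)).atTop_mul_const hd)).const_mul c
      simpa [Function.comp_def] using h
    refine tendsto_of_tendsto_of_tendsto_of_le_of_le' (hlim (𝒦 * d / (Es + 2 * Ec)))
      (hlim (4 * 𝒦 * d / Ec)) ?_ ?_
    · filter_upwards [eventually_ge_atTop 2] with n hn using (key n hn).1
    · filter_upwards [eventually_ge_atTop 2] with n hn using (key n hn).2
end

section
/- For a sensor network with fixed node density and fixed coverage area, the total obtainable information grows only logarithmically in the total consumed energy: there exist constants c > 0 and E⁰ > 0 such that for all E_t ≥ E⁰, I_t(E_t) ≤ c · log E_t, where I_t(E_t) = n² · 𝒦ₛ( β·(E_t − C)/n², ζ ). -/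
open Real MeasureTheory Filter

lemma ellipticK_nonneg_aux (k : ℝ) (h0 : 0 ≤ k) (h1 : k ≤ 1) : 0 ≤ ellipticK k := by
  unfold ellipticK
  apply intervalIntegral.integral_nonneg (by positivity)
  intro t _
  apply Real.rpow_nonneg
  have h2 : k ^ 2 ≤ 1 := by nlinarith
  have h3 := Real.sin_sq_le_one t
  nlinarith [sq_nonneg (Real.sin t), sq_nonneg k]

lemma Gz_bounds_aux (ζ : ℝ) (hζ : ζ ∈ Set.Ico (0 : ℝ) (1 / 4)) :
    ∃ M : ℝ, 0 ≤ M ∧ ∀ a b, 0 ≤ Gz ζ a b ∧ Gz ζ a b ≤ M := by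
  obtain ⟨h0, h1⟩ := hζ
  have hK := ellipticK_nonneg_aux (4 * ζ) (by linarith) (by linarith)
  have hp := Real.pi_pos
  have hκ : 0 ≤ (2 / π) * ellipticK (4 * ζ) := by positivity
  have hd : 0 < 1 - 4 * ζ := by linarith
  refine ⟨1 / ((2 / π) * ellipticK (4 * ζ) * (1 - 4 * ζ)), by positivity, fun a b => ?_⟩
  have hD : 1 - 4 * ζ ≤ Dz ζ a b := by
    unfold Dz
    nlinarith [Real.cos_le_one a, Real.cos_le_one b]
  have hD0 : 0 < Dz ζ a b := by linarith
  unfold Gz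
  refine ⟨by positivity, ?_⟩
  rcases hκ.eq_or_lt with h | h
  · rw [← h]; simp
  · apply one_div_le_one_div_of_le (by positivity)
    exact mul_le_mul_of_nonneg_left hD hκ

lemma Ks_le_aux (ζ M s : ℝ) (hs : 0 ≤ s)
    (hG : ∀ a b, 0 ≤ Gz ζ a b ∧ Gz ζ a b ≤ M) :
    Ks s ζ ≤ (1 / 2) * Real.log (1 + s * M) := by
  have hp := Real.pi_pos
  set B := (1 / 2) * Real.log (1 + s * M) with hB
  have key : ∀ a b, ‖(1 / 2) * Real.log (1 + s * Gz ζ a b) -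
      (1 / 2) * (1 - 1 / (1 + s * Gz ζ a b))‖ ≤ B := by
    intro a b
    obtain ⟨g0, g1⟩ := hG a b
    have hx : 1 ≤ 1 + s * Gz ζ a b := by nlinarith [mul_nonneg hs g0]
    have hx0 : 0 < 1 + s * Gz ζ a b := by linarith
    have l1 := Real.one_sub_inv_le_log_of_pos hx0
    have l2 : Real.log (1 + s * Gz ζ a b) ≤ Real.log (1 + s * M) :=
      Real.log_le_log hx0 (by nlinarith [mul_le_mul_of_nonneg_left g1 hs])
    have l3 := inv_le_one_of_one_le₀ hx
    rw [one_div (1 + s * Gz ζ a b), Real.norm_eq_abs, abs_le]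
    constructor <;> linarith
  have h1 : ‖∫ a in (-π)..π, ∫ b in (-π)..π,
    ((1 / 2) * Real.log (1 + s * Gz ζ a b) -
      (1 / 2) * (1 - 1 / (1 + s * Gz ζ a b)))‖ ≤ B * |π - -π| * |π - -π| := by
    apply intervalIntegral.norm_integral_le_of_norm_le_const
    intro a _
    apply intervalIntegral.norm_integral_le_of_norm_le_const
    intro b _
    exact key a b
  have h2 : |π - -π| = 2 * π := by rw [abs_of_pos] <;> linarith
  rw [h2] at h1
  unfold Ks
  calc _ ≤ (1 / (4 * π ^ 2)) * (B * (2 * π) * (2 * π)) :=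
        mul_le_mul_of_nonneg_left ((Real.le_norm_self _).trans h1) (by positivity)
    _ = B := by field_simp; ring

/-- **Fixed node density and fixed coverage area** (Theorem 7): with `n²` nodes,
fixed communication energy `C`, and measurement SNR `β·E_s` proportional to the
per-node sensing energy `E_s = (E_t − C)/n²`, the total information grows at
most logarithmically in the total consumed energy `E_t`. -/
theorem fixed_area_log_energy_growth
    (n : ℕ) (hn : 0 < n) (ζ : ℝ) (hζ : ζ ∈ Set.Ico (0 : ℝ) (1 / 4))
    (C β : ℝ) (hC : 0 ≤ C) (hβ : 0 < β) :
    ∃ c > (0 : ℝ), ∃ E0 > (0 : ℝ), ∀ Et : ℝ, E0 ≤ Et →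
      (n : ℝ) ^ 2 * Ks (β * (Et - C) / (n : ℝ) ^ 2) ζ ≤ c * Real.log Et := by
  obtain ⟨M, hM, hG⟩ := Gz_bounds_aux ζ hζ
  have hn' : (0 : ℝ) < (n : ℝ) ^ 2 := by positivity
  set q := β * M / (n : ℝ) ^ 2 with hq
  have hq0 : 0 ≤ q := by positivity
  refine ⟨(n : ℝ) ^ 2, hn', C + 1 + q, by positivity, fun Et hE => ?_⟩
  have hs : 0 ≤ β * (Et - C) / (n : ℝ) ^ 2 := by
    have : 0 ≤ Et - C := by linarith
    positivity
  apply mul_le_mul_of_nonneg_left _ hn'.le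
  refine (Ks_le_aux ζ M _ hs hG).trans ?_
  have e : β * (Et - C) / (n : ℝ) ^ 2 * M = q * (Et - C) := by rw [hq]; ring
  have h1 : 1 + β * (Et - C) / (n : ℝ) ^ 2 * M ≤ Et ^ 2 := by
    rw [e]
    nlinarith [mul_nonneg hq0 hC]
  have h2 := Real.log_le_log (by positivity) h1
  rw [Real.log_pow] at h2
  push_cast at h2
  linarith
end
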